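/- Let M = p²q²r² with p, q, r distinct primes, A, B ⊆ ℤ_M with A ⊕ B = ℤ_M, |A| = |B| = pqr, 0 ∈ A ∩ B, and suppose 1 ∉ Div(B). Then B is not of the form B_p ∪ B_q ∪ B_r ∪ B_{pqr} with B_p, B_q, B_r all nonempty, where B_p = (B ∩ pℤ)\(qℤ ∪ rℤ), B_q = (B ∩ qℤ)\(rℤ ∪ pℤ), B_r = (B ∩ rℤ)\(pℤ ∪ qℤ), B_{pqr} = B ∩ pqrℤ, assuming additionally that neither A nor B is contained in a proper subgroup of ℤ_M. -/

import Mathlib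

open Finset

/-- `A ⊕ B = ℤ_M`: unique representation of every element as `a + b`. -/
def Tiles {M : ℕ} (A B : Finset (ZMod M)) : Prop :=
  ∀ g : ZMod M, ∃! ab : ZMod M × ZMod M, ab.1 ∈ A ∧ ab.2 ∈ B ∧ ab.1 + ab.2 = g

/-- The division set `Div(E) = {gcd(a - a', M) : a, a' ∈ E}`. -/
def DivSet {M : ℕ} (E : Finset (ZMod M)) : Set ℕ :=
  {d | ∃ a ∈ E, ∃ b ∈ E, Nat.gcd ((a - b).val) M = d}

/-- `E` is not contained in any proper subgroup `dℤ_M` (`d ∣ M`, `d > 1`). -/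
def NotInProperSubgroup {M : ℕ} (E : Finset (ZMod M)) : Prop :=
  ∀ d : ℕ, d ∣ M → 1 < d → ∃ x ∈ E, ¬ d ∣ x.val

section Helpers

lemma cyc {p : ℕ} (hp : p.Prime) (x : ZMod p) (hx : x ≠ 0) (S : ZMod p → Prop)
    (h : ∀ i, S i → S (i - x)) (i0 : ZMod p) (h0 : S i0) : ∀ i, S i := by
  have := Fact.mk hp
  have key : ∀ n : ℕ, S (i0 - (n : ZMod p) * x) := by
    intro n
    induction n with
    | zero => simpa using h0
    | succ n ih =>
      have := h _ ih
      have e : i0 - ((n + 1 : ℕ) : ZMod p) * x = i0 - (n : ZMod p) * x - x := by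
        push_cast; ring
      rw [e]; exact this
  intro i
  have := key ((i0 - i) / x).val
  rw [ZMod.natCast_zmod_val, div_mul_cancel₀ _ hx] at this
  simpa using this

lemma two_mul_ne {p : ℕ} (hp : p.Prime) (h2 : p ≠ 2) (x : ZMod p) (hx : x ≠ 0) : x + x ≠ 0 := by
  have := Fact.mk hp
  intro h
  have h' : (2 : ZMod p) * x = 0 := by rw [two_mul]; exact h
  rcases mul_eq_zero.mp h' with h1 | h1
  · have : ((2 : ℕ) : ZMod p) = 0 := by exact_mod_cast h1
    rw [ZMod.natCast_eq_zero_iff] at this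
    exact h2 ((Nat.prime_dvd_prime_iff_eq hp Nat.prime_two).mp this)
  · exact hx h1

lemma exists_not_two {q : ℕ} (hq : q.Prime) (h2 : q ≠ 2) (a b : ZMod q) : ∃ c, c ≠ a ∧ c ≠ b := by
  have := Fact.mk hq
  by_contra hcon
  push Not at hcon
  have h1 : (Finset.univ : Finset (ZMod q)) ⊆ {a, b} := by
    intro c _
    simp only [mem_insert, mem_singleton]
    by_cases h : c = a
    · exact Or.inl h
    · exact Or.inr (hcon c h)
  have h3 := (card_le_card h1).trans card_le_two
  rw [Finset.card_univ, ZMod.card] at h3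
  have := hq.two_le
  omega

lemma exists_not_four {q : ℕ} (hq : q.Prime) (h4 : 4 < q) (a b c d : ZMod q) :
    ∃ e, e ≠ a ∧ e ≠ b ∧ e ≠ c ∧ e ≠ d := by
  have := Fact.mk hq
  by_contra hcon
  push Not at hcon
  have h1 : (Finset.univ : Finset (ZMod q)) ⊆ {a, b, c, d} := by
    intro e _
    simp only [mem_insert, mem_singleton]
    have := hcon e
    tauto
  have h3 := (card_le_card h1).trans card_le_four
  rw [Finset.card_univ, ZMod.card] at h3
  omega

lemma zmod2_eq : ∀ j j1 j2 : ZMod 2, j2 ≠ j → j1 ≠ j → j1 = j2 := by decide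

lemma iter_false {p q : ℕ} (hp : p.Prime) (hq : q.Prime) (hpq : p ≠ q) (x : ZMod p)
    (t : ZMod q) (ht : t ≠ 0) (J : ZMod p → ZMod q) (h : ∀ i, J (i - x) = J i + t) : False := by
  have := Fact.mk hq
  have key : ∀ n : ℕ, J (0 - (n : ZMod p) * x) = J 0 + (n : ZMod q) * t := by
    intro n
    induction n with
    | zero => simp
    | succ n ih =>
      have e : (0 : ZMod p) - ((n + 1 : ℕ) : ZMod p) * x = 0 - (n : ZMod p) * x - x := by
        push_cast; ring
      rw [e, h, ih]; push_cast; ring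
  have h1 := key p
  simp only [CharP.cast_eq_zero, zero_mul, sub_zero] at h1
  have h2 : (p : ZMod q) * t = 0 := by simpa using h1
  rcases mul_eq_zero.mp h2 with h3 | h3
  · rw [ZMod.natCast_eq_zero_iff] at h3
    exact hpq ((Nat.prime_dvd_prime_iff_eq hq hp).mp h3).symm
  · exact ht h3

section rows
variable {p q r : ℕ} (a : ZMod p → ZMod q → ZMod r → ℕ)

/-- row concentrated on one class of the second coordinate -/
def QC (a : ZMod p → ZMod q → ZMod r → ℕ) (i : ZMod p) : Prop :=
  ∃ j0, ∀ j k, a i j k ≠ 0 → j = j0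
def RC (a : ZMod p → ZMod q → ZMod r → ℕ) (i : ZMod p) : Prop :=
  ∃ k0, ∀ j k, a i j k ≠ 0 → k = k0
def Conv (a : ZMod p → ZMod q → ZMod r → ℕ) (x : ZMod p) (y : ZMod q) (z : ZMod r)
    (b0 b1 b2 b3 N : ℕ) : Prop :=
  ∀ i j k, a i j k * b0 + a i (j - y) (k - z) * b1 + a (i - x) j (k - z) * b2
    + a (i - x) (j - y) k * b3 = N

lemma mixQ (hq : q.Prime) (hr : r.Prime) (hr2 : r ≠ 2)
    {x : ZMod p} {y : ZMod q} {z : ZMod r} (hy : y ≠ 0) (hz : z ≠ 0) {b0 b1 b2 b3 N : ℕ}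
    (h2 : 0 < b2) (hN : 0 < N) (hc : Conv a x y z b0 b1 b2 b3 N) (i : ZMod p)
    (hQ : QC a i) (hR : RC a (i - x)) : QC a (i - x) := by
  obtain ⟨j, hj⟩ := hQ
  obtain ⟨k', hk⟩ := hR
  have hj' : ∀ j1 k1, j1 ≠ j → a i j1 k1 = 0 := fun j1 k1 h => by
    by_contra h'; exact h (hj _ _ h')
  have hk' : ∀ j1 k1, k1 ≠ k' → a (i - x) j1 k1 = 0 := fun j1 k1 h => by
    by_contra h'; exact h (hk _ _ h')
  have hzz := two_mul_ne hr hr2 z hz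
  have ez1 : k' - z ≠ k' := by intro h; apply hz; simpa using h
  have ez2 : k' - z - z ≠ k' := by
    intro h; apply hzz; rw [sub_sub] at h; simpa using h
  have ez3 : k' + z ≠ k' := by simpa using hz
  have ez4 : k' + z + z ≠ k' := by rw [add_assoc]; simpa using hzz
  have ey1 : j - y ≠ j := by simpa using hy
  have ey2 : j + y ≠ j := by simpa using hy
  by_cases hq2 : q = 2
  · have e1 := hc i j (k' - z)
    rw [hj' _ _ ey1, hk' _ _ ez2, hk' _ _ ez1] at e1
    have e2 := hc i (j + y) (k' + z + z)
    rw [hj' _ _ ey2, add_sub_cancel_right, add_sub_cancel_right, hk' _ _ ez3, hk' _ _ ez4] at e2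
    have e3 := hc i j (k' + z)
    rw [hj' _ _ ey1, hk' _ _ ez3, add_sub_cancel_right] at e3
    have e4 := hc i (j + y) k'
    rw [hj' _ _ ey2, hk' _ _ ez1, add_sub_cancel_right] at e4
    simp only [zero_mul, add_zero, zero_add] at e1 e2 e3 e4
    have g0 : a (i - x) j k' = 0 := by
      have f1 : 0 < a i j (k' - z) := by
        rcases Nat.eq_zero_or_pos (a i j (k' - z)) with h | h
        · rw [h] at e1; omega
        · exact h
      have f2 : 0 < a i j (k' + z) := by
        rcases Nat.eq_zero_or_pos (a i j (k' + z)) with h | h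
        · rw [h] at e2; omega
        · exact h
      have l1 : b0 ≤ b1 := by
        apply Nat.le_of_mul_le_mul_left _ f2
        omega
      have l2 : b1 ≤ b0 := by
        apply Nat.le_of_mul_le_mul_left _ f1
        omega
      have l3 : b0 = b1 := le_antisymm l1 l2
      subst l3
      have : a (i - x) j k' * b2 = 0 := by omega
      rcases Nat.mul_eq_zero.mp this with h | h
      · exact h
      · omega
    refine ⟨j + y, fun j1 k1 h => ?_⟩
    have hk1 := hk _ _ h
    subst hk1
    have hne : j1 ≠ j := by rintro rfl; exact h g0
    subst hq2
    exact zmod2_eq _ _ _ ey2 hne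
  · exfalso
    obtain ⟨j1, hj1, hj2⟩ := exists_not_two hq hq2 j (j + y)
    obtain ⟨k1, hk1, hk2⟩ := exists_not_two hr hr2 k' (k' + z)
    have e := hc i j1 k1
    rw [hj' _ _ hj1, hj' _ _ (fun h => hj2 (sub_eq_iff_eq_add.mp h)), hk' _ _ hk1,
      hk' _ _ (fun h => hk2 (sub_eq_iff_eq_add.mp h))] at e
    omega

lemma qq_le (hq : q.Prime) {x : ZMod p} {y : ZMod q} {z : ZMod r} {b0 b1 b2 b3 N : ℕ}
    (hN : 0 < N) (hc : Conv a x y z b0 b1 b2 b3 N) (i : ZMod p)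
    (hQ : QC a i) (hR : QC a (i - x)) : q ≤ 4 := by
  obtain ⟨j, hj⟩ := hQ
  obtain ⟨k', hk⟩ := hR
  have hj' : ∀ j1 k1, j1 ≠ j → a i j1 k1 = 0 := fun j1 k1 h => by
    by_contra h'; exact h (hj _ _ h')
  have hk' : ∀ j1 k1, j1 ≠ k' → a (i - x) j1 k1 = 0 := fun j1 k1 h => by
    by_contra h'; exact h (hk _ _ h')
  by_contra hcon
  obtain ⟨e, h1, h2, h3, h4⟩ := exists_not_four hq (by omega) j (j + y) k' (k' + y)
  have e := hc i e 0
  rw [hj' _ _ h1, hj' _ _ (fun h => h2 (sub_eq_iff_eq_add.mp h)), hk' _ _ h3,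
      hk' _ _ (fun h => h4 (sub_eq_iff_eq_add.mp h))] at e
  omega

lemma lt_aux {f g b0 b1 b2 b3 N : ℕ} (hN : 0 < N) (h2 : 0 < b2) (e1 : f * b0 = N)
    (e2 : f * b1 + g * b2 = N) (e3 : g * b3 = N) : b1 < b0 := by
  by_contra hcon
  have : f * b0 ≤ f * b1 := Nat.mul_le_mul_left _ (by omega)
  have h5 : g * b2 = 0 := by omega
  rcases Nat.mul_eq_zero.mp h5 with h6 | h6
  · rw [h6] at e3; omega
  · omega

lemma three (a : ZMod p → ZMod 3 → ZMod r → ℕ) (hp : p.Prime) (hp3 : p ≠ 3)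
    {x : ZMod p} {y : ZMod 3} {z : ZMod r} (hy : y ≠ 0) {b0 b1 b2 b3 N : ℕ}
    (hN : 0 < N) (h2 : 0 < b2) (h3 : 0 < b3)
    (hc : Conv a x y z b0 b1 b2 b3 N) (hQ : ∀ i, QC a i) : False := by
  choose J hJ using hQ
  have hz : ∀ i j1 k1, j1 ≠ J i → a i j1 k1 = 0 := fun i j1 k1 h => by
    by_contra h'; exact h (hJ _ _ _ h')
  have tri : ∀ y j j' : ZMod 3, y ≠ 0 → j' = j ∨ j' = j + y ∨ j' = j - y := by decide
  have d1 : ∀ y j : ZMod 3, y ≠ 0 → j - y ≠ j ∧ j + y ≠ j ∧ j - y ≠ j + y ∧ j - y - y = j + y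
    ∧ j + y + y = j - y := by decide
  have step : ∀ i, (J (i - x) = J i + y ∧ b1 < b0) ∨ (J (i - x) = J i - y ∧ b0 < b1) := by
    intro i
    obtain ⟨n1, n2, n3, n4, n5⟩ := d1 y (J i) hy
    rcases tri y (J i) (J (i - x)) hy with h | h | h
    · exfalso
      have e := hc i (J i - y) 0
      rw [hz i _ _ n1, n4, hz i _ _ n2, hz (i - x) _ _ (by rw [h]; exact n1),
        hz (i - x) _ _ (by rw [h]; exact n2)] at e
      omega
    · left
      refine ⟨h, ?_⟩
      have e1 := hc i (J i) 0
      rw [hz i _ _ n1, hz (i - x) (J i) _ (by rw [h]; exact n2.symm),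
        hz (i - x) (J i - y) _ (by rw [h]; exact n3)] at e1
      have e2 := hc i (J i + y) z
      rw [add_sub_cancel_right, hz i _ _ n2, sub_self,
        hz (i - x) (J i) _ (by rw [h]; exact n2.symm)] at e2
      have e3 := hc i (J i - y) 0
      rw [hz i _ _ n1, n4, hz i _ _ n2,
        hz (i - x) (J i - y) _ (by rw [h]; exact n3)] at e3
      simp only [zero_mul, add_zero, zero_add] at e1 e2 e3
      exact lt_aux hN h2 e1 e2 e3
    · right
      refine ⟨h, ?_⟩
      have e1 := hc i (J i) 0
      rw [hz i _ _ n1, hz (i - x) (J i) _ (by rw [h]; exact n1.symm)] at e1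
      have e2 := hc i (J i + y) z
      rw [add_sub_cancel_right, hz i _ _ n2, sub_self,
        hz (i - x) (J i) _ (by rw [h]; exact n1.symm),
        hz (i - x) (J i + y) _ (by rw [h]; exact n3.symm)] at e2
      have e3 := hc i (J i - y) z
      rw [hz i _ _ n1, n4, hz i _ _ n2, sub_self,
        hz (i - x) (J i + y) _ (by rw [h]; exact n3.symm)] at e3
      simp only [zero_mul, add_zero, zero_add] at e1 e2 e3
      exact lt_aux hN h3 e2 e1 e3
  by_cases hb : b1 < b0
  · refine iter_false hp Nat.prime_three hp3 x y hy J (fun i => ?_)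
    rcases step i with h | h
    · exact h.1
    · omega
  · refine iter_false hp Nat.prime_three hp3 x (-y) (neg_ne_zero.mpr hy) J (fun i => ?_)
    rcases step i with h | h
    · omega
    · rw [h.1, sub_eq_add_neg]

lemma Conv.swap {a : ZMod p → ZMod q → ZMod r → ℕ} {x : ZMod p} {y : ZMod q} {z : ZMod r}
    {b0 b1 b2 b3 N : ℕ} (hc : Conv a x y z b0 b1 b2 b3 N) :
    Conv (fun i k j => a i j k) x z y b0 b1 b3 b2 N := by
  intro i k j
  have := hc i j k
  simp only
  omega

lemma qq_le3 (hq : q.Prime) {x : ZMod p} {y : ZMod q} {z : ZMod r} {b0 b1 b2 b3 N : ℕ}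
    (hN : 0 < N) (hc : Conv a x y z b0 b1 b2 b3 N) (i : ZMod p)
    (hQ : QC a i) (hR : QC a (i - x)) : q = 2 ∨ q = 3 := by
  have h := qq_le a hq hN hc i hQ hR
  have := hq.two_le
  interval_cases q
  · simp
  · simp
  · exact absurd hq (by norm_num)

lemma rowlemma (hp : p.Prime) (hq : q.Prime) (hr : r.Prime) (hpq : p ≠ q) (hpr : p ≠ r)
    (hr2 : r ≠ 2) {x : ZMod p} {y : ZMod q} {z : ZMod r} (hx : x ≠ 0) (hy : y ≠ 0) (hz : z ≠ 0)
    {b0 b1 b2 b3 N : ℕ} (h2 : 0 < b2) (h3 : 0 < b3) (hN : 0 < N)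
    (hc : Conv a x y z b0 b1 b2 b3 N) (hrow : ∀ i, QC a i ∨ RC a i) : q = 2 ∧ ∀ i, QC a i := by
  by_cases hex : ∃ i, QC a i
  · obtain ⟨i0, hi0⟩ := hex
    have hall : ∀ i, QC a i := by
      apply cyc hp x hx _ _ i0 hi0
      intro i hi
      rcases hrow (i - x) with h | h
      · exact h
      · exact mixQ a hq hr hr2 hy hz h2 hN hc i hi h
    refine ⟨?_, hall⟩
    rcases qq_le3 a hq hN hc i0 hi0 (hall _) with h | h
    · exact h
    · exfalso
      subst h
      exact three a hp hpq hy hN h2 h3 hc hall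
  · exfalso
    push Not at hex
    have hall : ∀ i, QC (fun i k j => a i j k) i := by
      intro i
      rcases hrow i with h | ⟨k0, h⟩
      · exact absurd h (hex i)
      · exact ⟨k0, fun k j h' => h j k h'⟩
    rcases qq_le3 _ hr hN hc.swap 0 (hall _) (hall _) with h | h
    · exact hr2 h
    · subst h
      exact three _ hp hpr hz hN h3 h2 hc.swap hall

lemma const_of_rec (hp : p.Prime) (hp2 : p ≠ 2) {x : ZMod p} (hx : x ≠ 0) (m : ZMod p → ℕ)
    {U V C : ℕ} (hU : 0 < U) (hV : 0 < V) (h : ∀ i, m i * U + m (i - x) * V = C) :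
    ∀ i i', m i = m i' := by
  have := Fact.mk hp
  obtain ⟨i0, hi0⟩ := Finite.exists_max m
  have s1 : ∀ i, (∀ i', m i' ≤ m i) → ∀ i', m (i - x) ≤ m i' := by
    intro i hi i'
    have e1 := h i
    have e2 := h (i' + x)
    rw [add_sub_cancel_right] at e2
    have := Nat.mul_le_mul_right U (hi (i' + x))
    apply Nat.le_of_mul_le_mul_right _ hV
    omega
  have s2 : ∀ i, (∀ i', m i ≤ m i') → ∀ i', m i' ≤ m (i - x) := by
    intro i hi i'
    have e1 := h i
    have e2 := h (i' + x)
    rw [add_sub_cancel_right] at e2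
    have := Nat.mul_le_mul_right U (hi (i' + x))
    apply Nat.le_of_mul_le_mul_right _ hV
    omega
  have hall : ∀ i, ∀ i', m i' ≤ m i := by
    refine cyc hp (x + x) (two_mul_ne hp hp2 x hx) (fun i => ∀ i', m i' ≤ m i) ?_ i0 hi0
    intro i hi
    have := s2 _ (s1 i hi)
    rwa [sub_sub] at this
  intro i i'
  exact le_antisymm (hall _ _) (hall _ _)

lemma two_rows (a : ZMod p → ZMod 2 → ZMod r → ℕ) (hp : p.Prime) (hr : r.Prime) (hp2 : p ≠ 2)
    (hr2 : r ≠ 2) {x : ZMod p} {y : ZMod 2} {z : ZMod r} (hx : x ≠ 0) (hy : y ≠ 0) (hz : z ≠ 0)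
    {b0 b1 b2 b3 N : ℕ} (h0 : 0 < b0) (h2 : 0 < b2)
    (hN : 0 < N) (hb : b0 + b1 + b2 + b3 = N)
    (hc : Conv a x y z b0 b1 b2 b3 N) (J : ZMod p → ZMod 2)
    (hJ : ∀ i j k, a i j k ≠ 0 → j = J i) (hJn : ∃ i i', J i ≠ J i') :
    ∀ i k, a i (J i) k = 2 := by
  have := Fact.mk hp
  have := Fact.mk hr
  have hz0 : ∀ i j1 k1, j1 ≠ J i → a i j1 k1 = 0 := fun i j1 k1 h => by
    by_contra h'; exact h (hJ _ _ _ h')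
  have d1 : ∀ y j : ZMod 2, y ≠ 0 → j - y ≠ j ∧ j + y ≠ j := by decide
  obtain ⟨f, hf⟩ : ∃ f : ZMod p → ZMod r → ℕ, ∀ i k, f i k = a i (J i) k := ⟨_, fun _ _ => rfl⟩
  have hE : ∀ i, J (i - x) = J i → ∀ k, f i k * b0 + f (i - x) (k - z) * b2 = N ∧
      f i (k - z) * b1 + f (i - x) k * b3 = N := by
    intro i h k
    obtain ⟨n1, n2⟩ := d1 y (J i) hy
    have e1 := hc i (J i) k
    have e2 := hc i (J i + y) k
    rw [hz0 i _ _ n1, hz0 (i - x) (J i - y) _ (by rw [h]; exact n1)] at e1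
    rw [add_sub_cancel_right, hz0 i _ _ n2, hz0 (i - x) _ _ (by rw [h]; exact n2)] at e2
    simp only [hf, h]
    constructor <;> omega
  have hD : ∀ i, J (i - x) ≠ J i → ∀ k, f i k * b0 + f (i - x) k * b3 = N ∧
      f i k * b1 + f (i - x) k * b2 = N := by
    intro i h k
    obtain ⟨n1, n2⟩ := d1 y (J i) hy
    have e1 := hc i (J i) k
    have e2 := hc i (J i + y) (k + z)
    rw [hz0 i _ _ n1, hz0 (i - x) _ _ h.symm, ← zmod2_eq _ _ _ n1 h] at e1
    rw [add_sub_cancel_right, hz0 i _ _ n2, hz0 (i - x) _ _ h.symm, add_sub_cancel_right,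
      ← zmod2_eq _ _ _ n2 h] at e2
    simp only [hf]
    constructor <;> omega
  have hDex : ∃ i, J (i - x) ≠ J i := by
    by_contra hcon
    push Not at hcon
    obtain ⟨i, i', hii⟩ := hJn
    exact hii (cyc hp x hx (fun t => J t = J i') (fun t ht => by rw [hcon, ht]) i' rfl i)
  have hEex : ∃ i, J (i - x) = J i := by
    by_contra hcon
    push Not at hcon
    refine iter_false hp Nat.prime_two hp2 x y hy J (fun i => ?_)
    exact zmod2_eq _ _ _ (d1 y (J i) hy).2 (hcon i)
  obtain ⟨m, hm⟩ : ∃ m : ZMod p → ℕ, ∀ i, m i = ∑ k, f i k := ⟨_, fun _ => rfl⟩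
  have hm' : ∀ i, ∑ k, f i (k - z) = m i := by
    intro i
    rw [hm]
    exact Equiv.sum_comp (Equiv.subRight z) (f i)
  have hsum : ∀ g : ZMod r → ℕ, (∀ k, g k = N) → ∑ k, g k = r * N := by
    intro g hg
    simp [hg, ZMod.card]
  have hmE : ∀ i, J (i - x) = J i → m i * b0 + m (i - x) * b2 = r * N ∧
      m i * b1 + m (i - x) * b3 = r * N := by
    intro i h
    have e1 := hsum _ (fun k => (hE i h k).1)
    have e2 := hsum _ (fun k => (hE i h k).2)
    rw [sum_add_distrib, ← sum_mul, ← sum_mul, hm', ← hm] at e1 e2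
    exact ⟨e1, e2⟩
  have hmD : ∀ i, J (i - x) ≠ J i → m i * b0 + m (i - x) * b3 = r * N ∧
      m i * b1 + m (i - x) * b2 = r * N := by
    intro i h
    have e1 := hsum _ (fun k => (hD i h k).1)
    have e2 := hsum _ (fun k => (hD i h k).2)
    rw [sum_add_distrib, ← sum_mul, ← sum_mul, ← hm, ← hm] at e1 e2
    exact ⟨e1, e2⟩
  have hmU : ∀ i, m i * (b0 + b1) + m (i - x) * (b2 + b3) = 2 * (r * N) := by
    intro i
    simp only [mul_add]
    by_cases h : J (i - x) = J i
    · have := hmE i h; omega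
    · have := hmD i h; omega
  have hmc := const_of_rec hp hp2 hx m (by omega) (by omega) hmU
  have hm2 : ∀ i, m i = 2 * r := by
    intro i
    have e := hmU i
    rw [hmc (i - x) i, ← mul_add, ← add_assoc, hb] at e
    apply Nat.eq_of_mul_eq_mul_right hN
    rw [e]; ring
  obtain ⟨i1, hi1⟩ := hEex
  obtain ⟨i2, hi2⟩ := hDex
  have c1 := hmE i1 hi1
  have c2 := hmD i2 hi2
  simp only [hm2] at c1 c2
  have hrp := hr.pos
  have cc : ∀ s t, 2 * r * s + 2 * r * t = r * N → 2 * (s + t) = N := by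
    intro s t h
    apply Nat.eq_of_mul_eq_mul_left hrp
    rw [← h]; ring
  have c11 := cc _ _ c1.1
  have c12 := cc _ _ c1.2
  have c21 := cc _ _ c2.1
  have c22 := cc _ _ c2.2
  have hb01 : b1 = b0 := by omega
  have hb23 : b3 = b2 := by omega
  subst hb01 hb23
  have hconst : ∀ k, f (i1 - x) k = f (i1 - x) 0 := by
    refine cyc hr (z + z) (two_mul_ne hr hr2 z hz) (fun k => f (i1 - x) k = f (i1 - x) 0) ?_ 0 rfl
    intro k hk

    rw [← hk]
    have e1 := (hE i1 hi1 (k - z)).1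
    have e2 := (hE i1 hi1 k).2
    rw [sub_sub] at e1
    apply Nat.eq_of_mul_eq_mul_right h2
    omega
  have hstart : ∀ k, f (i1 - x) k = 2 := by
    have e := hm (i1 - x)
    rw [hm2, sum_congr rfl (fun k _ => hconst k)] at e
    simp only [sum_const, card_univ, ZMod.card, smul_eq_mul] at e
    intro k
    rw [hconst]
    apply Nat.eq_of_mul_eq_mul_left hrp
    rw [← e]; ring
  have hfin : ∀ i, ∀ k, f i k = 2 := by
    refine cyc hp (-x) (neg_ne_zero.mpr hx) (fun i => ∀ k, f i k = 2) ?_ _ hstart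
    intro i hi k
    rw [sub_neg_eq_add]
    apply Nat.eq_of_mul_eq_mul_right h0
    by_cases h : J (i + x - x) = J (i + x)
    · have := (hE _ h k).1
      rw [add_sub_cancel_right, hi] at this
      omega
    · have := (hD _ h k).1
      rw [add_sub_cancel_right, hi] at this
      omega
  intro i k
  rw [← hf]; exact hfin i k

end rows
/-- `n` dilates `A` and every element is still hit -/
def Hits {M : ℕ} (n : ℕ) (A B : Finset (ZMod M)) : Prop :=
  ∀ g : ZMod M, ∃ a ∈ A, ∃ b ∈ B, (n : ZMod M) * a + b = g

lemma hits_inj {M : ℕ} [NeZero M] {n : ℕ} {A B : Finset (ZMod M)} (hcard : A.card * B.card = M)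
    (h : Hits n A B) : ∀ a ∈ A, ∀ b ∈ B, ∀ a' ∈ A, ∀ b' ∈ B,
      (n : ZMod M) * a + b = (n : ZMod M) * a' + b' → a = a' ∧ b = b' := by
  have himg : (A ×ˢ B).image (fun ab : ZMod M × ZMod M => (n : ZMod M) * ab.1 + ab.2) = univ := by
    rw [eq_univ_iff_forall]
    intro g
    obtain ⟨a, ha, b, hb, e⟩ := h g
    exact mem_image.mpr ⟨(a, b), mem_product.mpr ⟨ha, hb⟩, e⟩
  have hc : ((A ×ˢ B).image (fun ab : ZMod M × ZMod M => (n : ZMod M) * ab.1 + ab.2)).card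
      = (A ×ˢ B).card := by
    rw [himg, card_product, hcard, card_univ, ZMod.card]
  have hinj := card_image_iff.mp hc
  intro a ha b hb a' ha' b' hb' e
  have := @hinj (a, b) (by simp [ha, hb]) (a', b') (by simp [ha', hb']) e
  simpa using this

lemma hits_prime {M : ℕ} [NeZero M] {n l : ℕ} (hl : l.Prime) {A B : Finset (ZMod M)}
    (hcard : A.card * B.card = M) (hlM : ¬ l ∣ M) (h : Hits n A B) : Hits (l * n) A B := by
  have := Fact.mk hl
  let s : ℕ → AddMonoidAlgebra (ZMod l) (ZMod M) := fun n =>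
    ∑ a ∈ A, AddMonoidAlgebra.single ((n : ZMod M) * a) (1 : ZMod l)
  let t : AddMonoidAlgebra (ZMod l) (ZMod M) := ∑ b ∈ B, AddMonoidAlgebra.single b (1 : ZMod l)
  let w : AddMonoidAlgebra (ZMod l) (ZMod M) := ∑ g : ZMod M, AddMonoidAlgebra.single g (1 : ZMod l)
  have hst : ∀ n, s n * t = ∑ ab ∈ A ×ˢ B,
      AddMonoidAlgebra.single ((n : ZMod M) * ab.1 + ab.2) (1 : ZMod l) := by
    intro n
    simp only [s, t]
    rw [sum_mul_sum, sum_product]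
    simp [AddMonoidAlgebra.single_mul_single]
  have h1 : s n * t = w := by
    rw [hst]
    refine sum_bij (fun ab _ => (n : ZMod M) * ab.1 + ab.2) (fun _ _ => mem_univ _) ?_ ?_ ?_
    · rintro ⟨a, b⟩ hab ⟨a', b'⟩ hab' e
      rw [mem_product] at hab hab'
      have := hits_inj hcard h a hab.1 b hab.2 a' hab'.1 b' hab'.2 e
      rw [this.1, this.2]
    · intro g _
      obtain ⟨a, ha, b, hb, e⟩ := h g
      exact ⟨(a, b), mem_product.mpr ⟨ha, hb⟩, e⟩
    · intro _ _; rfl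
  have hchar : CharP (AddMonoidAlgebra (ZMod l) (ZMod M)) l :=
    charP_of_injective_algebraMap (algebraMap (ZMod l) _).injective l
  have h2 : s n ^ l = s (l * n) := by
    simp only [s]
    rw [sum_pow_char]
    refine sum_congr rfl fun a _ => ?_
    rw [AddMonoidAlgebra.single_pow]
    simp [mul_assoc]
  have hw : ∀ g : ZMod M, AddMonoidAlgebra.single g (1 : ZMod l) * w = w := by
    intro g
    simp only [w]
    rw [mul_sum]
    simp only [AddMonoidAlgebra.single_mul_single, mul_one]
    exact Equiv.sum_comp (Equiv.addLeft g) (fun x => AddMonoidAlgebra.single x (1 : ZMod l))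
  have h3 : s n * w = (A.card : AddMonoidAlgebra (ZMod l) (ZMod M)) * w := by
    simp only [s]
    rw [sum_mul, sum_congr rfl (fun a _ => hw _), sum_const, nsmul_eq_mul]
  have h4 : ∀ e, s n ^ e * w = (A.card : AddMonoidAlgebra (ZMod l) (ZMod M)) ^ e * w := by
    intro e
    induction e with
    | zero => simp
    | succ e ih => rw [pow_succ, mul_assoc, h3, mul_left_comm, ih, pow_succ]; ring
  have h5 : s (l * n) * t = (A.card : AddMonoidAlgebra (ZMod l) (ZMod M)) ^ (l - 1) * w := by
    rw [← h2, ← h4, ← h1]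
    obtain ⟨k, rfl⟩ : ∃ k, l = k + 1 := ⟨l - 1, by have := hl.pos; omega⟩
    simp only [Nat.add_sub_cancel]
    ring
  have hA0 : (A.card : ZMod l) ≠ 0 := by
    intro h0
    rw [ZMod.natCast_eq_zero_iff] at h0
    exact hlM (hcard ▸ h0.mul_right _)
  have h6 : (A.card : AddMonoidAlgebra (ZMod l) (ZMod M)) ^ (l - 1) = 1 := by
    have e := ZMod.pow_card_sub_one_eq_one hA0
    have e' := congrArg (algebraMap (ZMod l) (AddMonoidAlgebra (ZMod l) (ZMod M))) e
    rw [map_pow, map_natCast, map_one] at e'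
    exact e'
  rw [h6, one_mul, hst] at h5
  intro g
  by_contra hcon
  push Not at hcon
  have h7 := congrArg (fun f : AddMonoidAlgebra (ZMod l) (ZMod M) => f.coeff g) h5
  simp only [w, AddMonoidAlgebra.coeff_sum, AddMonoidAlgebra.coeff_single, Finsupp.finsetSum_apply,
    Finsupp.single_apply] at h7
  rw [sum_eq_zero, sum_ite_eq' univ g] at h7
  · simp at h7
  · rintro ⟨a, b⟩ hab
    rw [mem_product] at hab
    rw [if_neg]
    exact hcon a hab.1 b hab.2

lemma hits_coprime {M : ℕ} [NeZero M] {A B : Finset (ZMod M)}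
    (hcard : A.card * B.card = M) (hT : Hits 1 A B) (n : ℕ) (hn : n.Coprime M) (hn0 : n ≠ 0) :
    Hits n A B := by
  induction n using induction_on_primes with
  | zero => exact absurd rfl hn0
  | one => exact hT
  | prime_mul l n hl ih =>
    apply hits_prime hl hcard
    · exact (Nat.Prime.coprime_iff_not_dvd hl).mp (Nat.Coprime.coprime_dvd_left ⟨n, rfl⟩ hn)
    · exact ih (Nat.Coprime.coprime_dvd_left ⟨l, by ring⟩ hn) (by rintro rfl; simp at hn0)

lemma gcd_unit_mul {M : ℕ} [NeZero M] (u : (ZMod M)ˣ) (d : ℕ) (hd : d ∣ M) :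
    Nat.gcd ((u : ZMod M) * d).val M = d := by
  rw [ZMod.val_mul, ← Nat.gcd_rec, Nat.gcd_comm, ZMod.val_natCast,
    Nat.Coprime.gcd_mul_left_cancel _ (ZMod.val_coe_unit_coprime u), ← Nat.gcd_rec, Nat.gcd_comm]
  exact Nat.gcd_eq_left hd

lemma exists_mul_of_gcd {M : ℕ} [NeZero M] (d e : ZMod M)
    (h : Nat.gcd d.val M = Nat.gcd e.val M) : ∃ u : (ZMod M)ˣ, e = u * d := by
  obtain ⟨d0, hd0, u, ⟨u, rfl⟩, rfl⟩ := d.eq_unit_mul_divisor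
  obtain ⟨e0, he0, v, ⟨v, rfl⟩, rfl⟩ := e.eq_unit_mul_divisor
  rw [gcd_unit_mul _ _ hd0, gcd_unit_mul _ _ he0] at h
  subst h
  refine ⟨v * u⁻¹, ?_⟩
  push_cast
  rw [mul_assoc, ← mul_assoc _ (u : ZMod M), Units.inv_mul, one_mul]

lemma sands {M : ℕ} (hM : 1 < M) {A B : Finset (ZMod M)} (hT : Tiles A B)
    (hcard : A.card * B.card = M) {a a' b b' : ZMod M} (ha : a ∈ A) (ha' : a' ∈ A)
    (hb : b ∈ B) (hb' : b' ∈ B)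
    (h : Nat.gcd (a - a').val M = Nat.gcd (b - b').val M) : a = a' := by
  have : NeZero M := ⟨by omega⟩
  have hH : Hits 1 A B := by
    intro g
    obtain ⟨⟨a, b⟩, ⟨h1, h2, h3⟩, _⟩ := hT g
    exact ⟨a, h1, b, h2, by simpa using h3⟩
  obtain ⟨u, hu⟩ := exists_mul_of_gcd _ _ h
  have hc := ZMod.val_coe_unit_coprime u
  have hn0 : (u : ZMod M).val ≠ 0 := by
    intro h0
    rw [h0, Nat.coprime_zero_left] at hc
    omega
  have hH' := hits_coprime hcard hH _ hc hn0
  refine (hits_inj hcard hH' a ha b' hb' a' ha' b hb ?_).1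
  rw [ZMod.natCast_zmod_val]
  linear_combination -hu

lemma gcd_sq {p v v' : ℕ} (hp : p.Prime) (h1 : p ∣ v ↔ p ∣ v') (h2 : p ^ 2 ∣ v ↔ p ^ 2 ∣ v') :
    Nat.gcd v (p ^ 2) = Nat.gcd v' (p ^ 2) := by
  apply Nat.dvd_antisymm
  · apply Nat.dvd_gcd _ (Nat.gcd_dvd_right _ _)
    obtain ⟨k, hk, e⟩ := (Nat.dvd_prime_pow hp).mp (Nat.gcd_dvd_right v (p ^ 2))
    have hd : p ^ k ∣ v := e ▸ Nat.gcd_dvd_left v (p ^ 2)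
    rw [e]
    interval_cases k
    · simp
    · simpa using h1.mp (by simpa using hd)
    · exact h2.mp hd
  · apply Nat.dvd_gcd _ (Nat.gcd_dvd_right _ _)
    obtain ⟨k, hk, e⟩ := (Nat.dvd_prime_pow hp).mp (Nat.gcd_dvd_right v' (p ^ 2))
    have hd : p ^ k ∣ v' := e ▸ Nat.gcd_dvd_left v' (p ^ 2)
    rw [e]
    interval_cases k
    · simp
    · simpa using h1.mpr (by simpa using hd)
    · exact h2.mpr hd

lemma cast_zero_iff {M d : ℕ} [NeZero M] (hd : d ∣ M) (x : ZMod M) :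
    ZMod.castHom hd (ZMod d) x = 0 ↔ d ∣ x.val := by
  rw [ZMod.castHom_apply, ZMod.cast_eq_val, ZMod.natCast_eq_zero_iff]

lemma cast_eq_iff {M d : ℕ} [NeZero M] (hd : d ∣ M) (x y : ZMod M) :
    ZMod.castHom hd (ZMod d) x = ZMod.castHom hd (ZMod d) y ↔ d ∣ (x - y).val := by
  rw [← cast_zero_iff hd, map_sub, sub_eq_zero]

lemma cast_comp {M d e : ℕ} (hd : d ∣ M) (hed : e ∣ d) (x : ZMod M) :
    ZMod.castHom hed (ZMod e) (ZMod.castHom hd (ZMod d) x)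
      = ZMod.castHom (hed.trans hd) (ZMod e) x := by
  rw [← RingHom.comp_apply, Subsingleton.elim ((ZMod.castHom hed (ZMod e)).comp _) (ZMod.castHom (hed.trans hd) (ZMod e))]

lemma fiber_card_le {p : ℕ} (hp : p.Prime) (T : Finset (ZMod (p ^ 2)))
    (h : ∀ s ∈ T, ∀ t ∈ T, ZMod.castHom (dvd_pow_self p two_ne_zero) (ZMod p) s
      = ZMod.castHom (dvd_pow_self p two_ne_zero) (ZMod p) t) : T.card ≤ p := by
  have := Fact.mk hp
  have : NeZero (p ^ 2) := ⟨pow_ne_zero _ hp.ne_zero⟩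
  refine le_of_le_of_eq ?_ (card_range p)
  apply card_le_card_of_injOn (fun t => t.val / p)
  · intro t _
    simp only [coe_range, Set.mem_Iio]
    apply Nat.div_lt_of_lt_mul
    exact lt_of_lt_of_eq t.val_lt (pow_two p)

  · intro s hs t ht e
    have h1 := h s hs t ht
    simp only [ZMod.castHom_apply, ZMod.cast_eq_val] at h1
    rw [ZMod.natCast_eq_natCast_iff'] at h1
    apply ZMod.val_injective
    simp only at e
    rw [← Nat.div_add_mod s.val p, ← Nat.div_add_mod t.val p, e, h1]

lemma conv_count {M N : ℕ} [NeZero M] {T : Type*} [AddCommGroup T] [Fintype T] [DecidableEq T]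
    (φ : ZMod M →+ T) (hs : Function.Surjective φ) (hN : Fintype.card T * N = M)
    (hT0 : 0 < Fintype.card T)
    {A B : Finset (ZMod M)} (hT : Tiles A B) (t : T) :
    ∑ b ∈ B, (A.filter (fun a => φ a = t - φ b)).card = N := by
  have h1 : ∀ s : T, (univ.filter (fun g => φ g = s)).card = (univ.filter (fun g => φ g = t)).card :=
    fun s => AddMonoidHom.card_fiber_eq_of_mem_range φ (hs s) (hs t)
  have h2 : M = ∑ s : T, (univ.filter (fun g => φ g = s)).card := by
    rw [← card_eq_sum_card_fiberwise (fun _ _ => mem_coe.mpr (mem_univ _)), card_univ, ZMod.card]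
  have h3 : (univ.filter (fun g => φ g = t)).card = N := by
    rw [sum_congr rfl (fun s _ => h1 s), sum_const, card_univ, smul_eq_mul] at h2
    apply Nat.eq_of_mul_eq_mul_left hT0
    rw [hN, ← h2]
  rw [← h3, ← card_sigma]
  refine card_bij (fun (x : Σ _ : ZMod M, ZMod M) _ => x.2 + x.1) ?_ ?_ ?_
  · rintro ⟨b, a⟩ h
    simp only [mem_sigma, mem_filter] at h
    simp [h.2.2]
  · rintro ⟨b, a⟩ h ⟨b', a'⟩ h' e
    simp only [mem_sigma, mem_filter] at h h'
    simp only at e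
    obtain ⟨ab, _, huniq⟩ := hT (a + b)
    have e1 := huniq (a, b) ⟨h.2.1, h.1, rfl⟩
    have e2 := huniq (a', b') ⟨h'.2.1, h'.1, e.symm⟩
    have e3 := e1.trans e2.symm
    simp only [Prod.mk.injEq] at e3
    rw [e3.1, e3.2]
  · intro g hg
    simp only [mem_filter, mem_univ, true_and] at hg
    obtain ⟨⟨a, b⟩, ⟨ha, hb, hab⟩, _⟩ := hT g
    refine ⟨⟨b, a⟩, ?_, hab⟩
    simp only [mem_sigma, mem_filter]
    refine ⟨hb, ha, ?_⟩
    rw [← hg, ← hab, map_add]; simp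

end Helpers

section Helpers2

lemma or4_23 {a b c d : Prop} (h : a ∨ b ∨ c ∨ d) : a ∨ b ∨ d ∨ c := by tauto

lemma or4_12 {a b c d : Prop} (h : a ∨ b ∨ c ∨ d) : a ∨ c ∨ b ∨ d := by tauto

lemma and3_23 {a b c : Prop} : a ∧ b ∧ c ↔ a ∧ c ∧ b := by tauto

lemma and3_12 {a b c : Prop} : a ∧ b ∧ c ↔ b ∧ a ∧ c := by tauto

lemma not_iff_not_aux {a b : Prop} (h : ¬ (a ↔ ¬ b)) : a ↔ b := by tauto

lemma vol_lt {p q r x0 x1 x2 x3 y0 y1 y2 y3 z0 z1 z2 z3 : ℕ}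
    (hx0 : 0 < x0) (hx1 : 0 < x1) (hx2 : 0 < x2) (hx3 : 0 < x3)
    (hy0 : 0 < y0) (hy1 : 0 < y1) (hy2 : 0 < y2) (hy3 : 0 < y3)
    (hz0 : 0 < z0) (hz1 : 0 < z1) (hz2 : 0 < z2) (hz3 : 0 < z3)
    (hx01 : x0 + x1 ≤ p) (hx23 : x2 + x3 ≤ p) (hy02 : y0 + y2 ≤ q) (hy13 : y1 + y3 ≤ q)
    (hz03 : z0 + z3 ≤ r) (hz12 : z1 + z2 ≤ r) :
    x0 * y0 * z0 + x1 * y1 * z1 + x2 * y2 * z2 + x3 * y3 * z3 < p * q * r := by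
  obtain ⟨X1, h1, e1⟩ : ∃ X1, x1 ≤ X1 ∧ p = x0 + X1 := ⟨p - x0, by omega, by omega⟩
  obtain ⟨X3, h2, e2⟩ : ∃ X1, x3 ≤ X1 ∧ p = x2 + X1 := ⟨p - x2, by omega, by omega⟩
  obtain ⟨Y2, h3, e3⟩ : ∃ X1, y2 ≤ X1 ∧ q = y0 + X1 := ⟨q - y0, by omega, by omega⟩
  obtain ⟨Y3, h4, e4⟩ : ∃ X1, y3 ≤ X1 ∧ q = y1 + X1 := ⟨q - y1, by omega, by omega⟩
  obtain ⟨Z3, h5, e5⟩ : ∃ X1, z3 ≤ X1 ∧ r = z0 + X1 := ⟨r - z0, by omega, by omega⟩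
  obtain ⟨Z2, h6, e6⟩ : ∃ X1, z2 ≤ X1 ∧ r = z1 + X1 := ⟨r - z1, by omega, by omega⟩
  have le : x0 * y0 * z0 + x1 * y1 * z1 + x2 * y2 * z2 + x3 * y3 * z3 ≤
    x0 * y0 * z0 + X1 * y1 * z1 + x2 * Y2 * Z2 + X3 * Y3 * Z3 := by gcongr
  refine lt_of_le_of_lt le ?_
  have hX1 : 0 < X1 := by omega
  have hX3 : 0 < X3 := by omega
  have hY2 : 0 < Y2 := by omega
  have hY3 : 0 < Y3 := by omega
  have hZ2 : 0 < Z2 := by omega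
  have hZ3 : 0 < Z3 := by omega
  have key : (x0 * y0 * z0) * ((x2 + X3) * (y1 + Y3) * (z1 + Z2))
      + (X1 * y1 * z1) * ((x2 + X3) * (y0 + Y2) * (z0 + Z3))
      + (x2 * Y2 * Z2) * ((x0 + X1) * (y1 + Y3) * (z0 + Z3))
      + (X3 * Y3 * Z3) * ((x0 + X1) * (y0 + Y2) * (z1 + Z2))
      < ((x0 + X1) * (y0 + Y2) * (z0 + Z3)) * ((x2 + X3) * (y1 + Y3) * (z1 + Z2)) := by
    zify at *
    rw [← sub_pos]
    ring_nf
    positivity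
  rw [← e1, ← e2, ← e3, ← e4, ← e5, ← e6, ← add_mul, ← add_mul, ← add_mul] at key
  exact lt_of_mul_lt_mul_right key (Nat.zero_le _)

lemma width_aux {G α : Type*} [DecidableEq G] [DecidableEq α] (u2 : G → α) (S T : Finset G)
    (hS : S.Nonempty) (hT : T.Nonempty)
    {p : ℕ} (hp : 2 ≤ p) (P : Prop) (hx : ∀ b ∈ S, ∀ b' ∈ T, (P ↔ ¬ u2 b = u2 b'))
    (hf : ((S ∪ T).image u2).card ≤ p) :
    (S.image u2).card + (T.image u2).card ≤ p ∧
      (¬ P → (S.image u2).card = 1 ∧ (T.image u2).card = 1) := by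
  obtain ⟨s, hs⟩ := hS
  obtain ⟨t, ht⟩ := hT
  by_cases hP : P
  · refine ⟨?_, fun h => absurd hP h⟩
    rw [image_union, card_union_of_disjoint] at hf
    · exact hf
    · rw [disjoint_left]
      intro c h1 h2
      obtain ⟨b, hb, rfl⟩ := mem_image.mp h1
      obtain ⟨b', hb', e⟩ := mem_image.mp h2
      exact (hx b hb b' hb').mp hP e.symm
  · have h1 : (S.image u2).card = 1 := by
      rw [card_eq_one]
      refine ⟨u2 t, ?_⟩
      ext c
      simp only [mem_image, mem_singleton]
      constructor
      · rintro ⟨b, hb, rfl⟩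
        by_contra h
        exact hP ((hx b hb t ht).mpr h)
      · rintro rfl
        refine ⟨s, hs, ?_⟩
        by_contra h
        exact hP ((hx s hs t ht).mpr h)
    have h2 : (T.image u2).card = 1 := by
      rw [card_eq_one]
      refine ⟨u2 s, ?_⟩
      ext c
      simp only [mem_image, mem_singleton]
      constructor
      · rintro ⟨b, hb, rfl⟩
        by_contra h
        exact hP ((hx s hs b hb).mpr (fun e => h e.symm))
      · rintro rfl
        refine ⟨t, ht, ?_⟩
        by_contra h
        exact hP ((hx s hs t ht).mpr (fun e => h e.symm))
    exact ⟨by omega, fun _ => ⟨h1, h2⟩⟩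

lemma box_card {G α β γ : Type*} [DecidableEq α] [DecidableEq β] [DecidableEq γ]
    (S : Finset G) (f : G → α) (g : G → β) (h : G → γ)
    (inj : ∀ a b, f a = f b → g a = g b → h a = h b → a = b) :
    S.card ≤ (S.image f).card * (S.image g).card * (S.image h).card := by
  rw [← card_product, ← card_product]
  apply card_le_card_of_injOn (fun x => ((f x, g x), h x))
  · intro x hx
    have hx := mem_coe.mp hx
    simp only [mem_coe, mem_product]
    exact ⟨⟨mem_image_of_mem _ hx, mem_image_of_mem _ hx⟩, mem_image_of_mem _ hx⟩
  · intro x _ y _ e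
    simp only [Prod.mk.injEq] at e
    exact inj _ _ e.1.1 e.1.2 e.2

/-- counting function of the residues of `A` -/
def cnt {p q r : ℕ} {G : Type} (A : Finset G) (u : G → ZMod p) (v : G → ZMod q) (w : G → ZMod r)
    (i : ZMod p) (j : ZMod q) (k : ZMod r) : ℕ :=
  (A.filter (fun g => u g = i ∧ v g = j ∧ w g = k)).card

structure Cfg (p q r : ℕ) {G : Type} [DecidableEq G] (A B0 B1 B2 B3 : Finset G)
    (u : G → ZMod p) (v : G → ZMod q) (w : G → ZMod r)
    (u2 : G → ZMod (p ^ 2)) (v2 : G → ZMod (q ^ 2)) (w2 : G → ZMod (r ^ 2))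
    (x : ZMod p) (y : ZMod q) (z : ZMod r) : Prop where
  hp : p.Prime
  hq : q.Prime
  hr : r.Prime
  hpq : p ≠ q
  hqr : q ≠ r
  hpr : p ≠ r
  hu : ∀ g h, u2 g = u2 h → u g = u h
  hv : ∀ g h, v2 g = v2 h → v g = v h
  hw : ∀ g h, w2 g = w2 h → w g = w h
  inj : ∀ g h, u2 g = u2 h → v2 g = v2 h → w2 g = w2 h → g = h
  fu : ∀ S : Finset G, (∀ g ∈ S, ∀ h ∈ S, u g = u h) → (S.image u2).card ≤ p
  fv : ∀ S : Finset G, (∀ g ∈ S, ∀ h ∈ S, v g = v h) → (S.image v2).card ≤ q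
  fw : ∀ S : Finset G, (∀ g ∈ S, ∀ h ∈ S, w g = w h) → (S.image w2).card ≤ r
  sands : ∀ a a' b b', a ∈ A → a' ∈ A → (b ∈ B0 ∨ b ∈ B1 ∨ b ∈ B2 ∨ b ∈ B3) →
    (b' ∈ B0 ∨ b' ∈ B1 ∨ b' ∈ B2 ∨ b' ∈ B3) →
    (u a = u a' ↔ u b = u b') → (v a = v a' ↔ v b = v b') → (w a = w a' ↔ w b = w b') →
    (u2 a = u2 a' ↔ u2 b = u2 b') → (v2 a = v2 a' ↔ v2 b = v2 b') →
    (w2 a = w2 a' ↔ w2 b = w2 b') → a = a'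
  conv : Conv (cnt A u v w) x y z B0.card B1.card B2.card B3.card (p * q * r)
  cardB : B0.card + B1.card + B2.card + B3.card = p * q * r
  hx : x ≠ 0
  hy : y ≠ 0
  hz : z ≠ 0
  n0 : B0.Nonempty
  n1 : B1.Nonempty
  n2 : B2.Nonempty
  n3 : B3.Nonempty
  t0 : ∀ g ∈ B0, u g = 0 ∧ v g = 0 ∧ w g = 0
  t1 : ∀ g ∈ B1, u g = 0 ∧ v g = y ∧ w g = z
  t2 : ∀ g ∈ B2, u g = x ∧ v g = 0 ∧ w g = z
  t3 : ∀ g ∈ B3, u g = x ∧ v g = y ∧ w g = 0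
  au : ∃ a ∈ A, ∃ a' ∈ A, u a ≠ u a'
  av : ∃ a ∈ A, ∃ a' ∈ A, v a ≠ v a'
  aw : ∃ a ∈ A, ∃ a' ∈ A, w a ≠ w a'

namespace Cfg
variable {p q r : ℕ} {G : Type} [DecidableEq G] {A B0 B1 B2 B3 : Finset G}
    {u : G → ZMod p} {v : G → ZMod q} {w : G → ZMod r}
    {u2 : G → ZMod (p ^ 2)} {v2 : G → ZMod (q ^ 2)} {w2 : G → ZMod (r ^ 2)}
    {x : ZMod p} {y : ZMod q} {z : ZMod r}

lemma swap23 (c : Cfg p q r A B0 B1 B2 B3 u v w u2 v2 w2 x y z) :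
    Cfg p r q A B0 B1 B3 B2 u w v u2 w2 v2 x z y where
  hp := c.hp
  hq := c.hr
  hr := c.hq
  hpq := c.hpr
  hqr := c.hqr.symm
  hpr := c.hpq
  hu := c.hu
  hv := c.hw
  hw := c.hv
  inj := fun g h h1 h2 h3 => c.inj g h h1 h3 h2
  fu := c.fu
  fv := c.fw
  fw := c.fv
  sands := fun a a' b b' h1 h2 h3 h4 h5 h6 h7 h8 h9 h10 =>
    c.sands a a' b b' h1 h2 (or4_23 h3) (or4_23 h4) h5 h7 h6 h8 h10 h9
  conv := by
    have e : cnt A u w v = fun i k j => cnt A u v w i j k := by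
      funext i k j
      simp only [cnt]
      congr 1
      apply filter_congr
      intro g _
      exact and3_23
    rw [e]
    have := c.conv.swap
    rwa [mul_right_comm] at this
  cardB := by have := c.cardB; rw [mul_right_comm] at this; omega
  hx := c.hx
  hy := c.hz
  hz := c.hy
  n0 := c.n0
  n1 := c.n1
  n2 := c.n3
  n3 := c.n2
  t0 := fun g hg => by have := c.t0 g hg; exact and3_23.mp this
  t1 := fun g hg => by have := c.t1 g hg; exact and3_23.mp this
  t2 := fun g hg => by have := c.t3 g hg; exact and3_23.mp this
  t3 := fun g hg => by have := c.t2 g hg; exact and3_23.mp this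
  au := c.au
  av := c.aw
  aw := c.av

lemma swap12 (c : Cfg p q r A B0 B1 B2 B3 u v w u2 v2 w2 x y z) :
    Cfg q p r A B0 B2 B1 B3 v u w v2 u2 w2 y x z where
  hp := c.hq
  hq := c.hp
  hr := c.hr
  hpq := c.hpq.symm
  hqr := c.hpr
  hpr := c.hqr
  hu := c.hv
  hv := c.hu
  hw := c.hw
  inj := fun g h h1 h2 h3 => c.inj g h h2 h1 h3
  fu := c.fv
  fv := c.fu
  fw := c.fw
  sands := fun a a' b b' h1 h2 h3 h4 h5 h6 h7 h8 h9 h10 =>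
    c.sands a a' b b' h1 h2 (or4_12 h3) (or4_12 h4) h6 h5 h7 h9 h8 h10
  conv := by
    have e : cnt A v u w = fun j i k => cnt A u v w i j k := by
      funext i k j
      simp only [cnt]
      congr 1
      apply filter_congr
      intro g _
      exact and3_12
    rw [e]
    intro j i k
    have := c.conv i j k
    rw [mul_comm q p]
    simp only
    omega
  cardB := by have := c.cardB; rw [mul_comm q p]; omega
  hx := c.hy
  hy := c.hx
  hz := c.hz
  n0 := c.n0
  n1 := c.n2
  n2 := c.n1
  n3 := c.n3
  t0 := fun g hg => by have := c.t0 g hg; exact and3_12.mp this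
  t1 := fun g hg => by have := c.t2 g hg; exact and3_12.mp this
  t2 := fun g hg => by have := c.t1 g hg; exact and3_12.mp this
  t3 := fun g hg => by have := c.t3 g hg; exact and3_12.mp this
  au := c.av
  av := c.au
  aw := c.aw

lemma xor_u (c : Cfg p q r A B0 B1 B2 B3 u v w u2 v2 w2 x y z) {a a' b b' : G}
    (ha : a ∈ A) (ha' : a' ∈ A) (hb : b ∈ B0 ∨ b ∈ B1 ∨ b ∈ B2 ∨ b ∈ B3)
    (hb' : b' ∈ B0 ∨ b' ∈ B1 ∨ b' ∈ B2 ∨ b' ∈ B3)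
    (h1 : u a = u a') (h2 : v a ≠ v a') (h3 : w a ≠ w a')
    (k1 : u b = u b') (k2 : v b ≠ v b') (k3 : w b ≠ w b') :
    (u2 a = u2 a' ↔ ¬ u2 b = u2 b') := by
  by_contra hcon
  have e : u2 a = u2 a' ↔ u2 b = u2 b' := not_iff_not_aux hcon
  have hv1 := mt (c.hv a a') h2
  have hv2 := mt (c.hv b b') k2
  have hw1 := mt (c.hw a a') h3
  have hw2 := mt (c.hw b b') k3
  have := c.sands a a' b b' ha ha' hb hb' (iff_of_true h1 k1)
    (iff_of_false h2 k2) (iff_of_false h3 k3) e (iff_of_false hv1 hv2) (iff_of_false hw1 hw2)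
  rw [this] at h2
  exact h2 rfl

lemma width_u (c : Cfg p q r A B0 B1 B2 B3 u v w u2 v2 w2 x y z) {a a' : G}
    (ha : a ∈ A) (ha' : a' ∈ A) (h1 : u a = u a') (h2 : v a ≠ v a') (h3 : w a ≠ w a') :
    ((B0.image u2).card + (B1.image u2).card ≤ p ∧ (B2.image u2).card + (B3.image u2).card ≤ p) ∧
    (¬ u2 a = u2 a' → ((B0.image u2).card = 1 ∧ (B1.image u2).card = 1) ∧
      (B2.image u2).card = 1 ∧ (B3.image u2).card = 1) := by
  have w1 := width_aux u2 B0 B1 c.n0 c.n1 c.hp.two_le (u2 a = u2 a')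
    (fun b hb b' hb' => by
      obtain ⟨e1, e2, e3⟩ := c.t0 b hb
      obtain ⟨f1, f2, f3⟩ := c.t1 b' hb'
      exact c.xor_u ha ha' (Or.inl hb) (Or.inr (Or.inl hb')) h1 h2 h3 (by rw [e1, f1])
        (by rw [e2, f2]; exact c.hy.symm) (by rw [e3, f3]; exact c.hz.symm))
    (c.fu _ (fun g hg h hh => by
      have k : ∀ g ∈ B0 ∪ B1, u g = 0 := fun g hg => by
        rcases mem_union.mp hg with h | h
        · exact (c.t0 g h).1
        · exact (c.t1 g h).1
      rw [k g hg, k h hh]))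
  have w2 := width_aux u2 B2 B3 c.n2 c.n3 c.hp.two_le (u2 a = u2 a')
    (fun b hb b' hb' => by
      obtain ⟨e1, e2, e3⟩ := c.t2 b hb
      obtain ⟨f1, f2, f3⟩ := c.t3 b' hb'
      exact c.xor_u ha ha' (Or.inr (Or.inr (Or.inl hb))) (Or.inr (Or.inr (Or.inr hb'))) h1 h2 h3
        (by rw [e1, f1]) (by rw [e2, f2]; exact c.hy.symm) (by rw [e3, f3]; exact c.hz))
    (c.fu _ (fun g hg h hh => by
      have k : ∀ g ∈ B2 ∪ B3, u g = x := fun g hg => by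
        rcases mem_union.mp hg with h | h
        · exact (c.t2 g h).1
        · exact (c.t3 g h).1
      rw [k g hg, k h hh]))
  exact ⟨⟨w1.1, w2.1⟩, fun h => ⟨w1.2 h, w2.2 h⟩⟩

lemma row_type (A : Finset G) (u : G → ZMod p) (v : G → ZMod q) (w : G → ZMod r)
    (h : ∀ a ∈ A, ∀ a' ∈ A, u a = u a' → v a = v a' ∨ w a = w a') (i : ZMod p) :
    QC (cnt A u v w) i ∨ RC (cnt A u v w) i := by
  have mem : ∀ j k, cnt A u v w i j k ≠ 0 → ∃ a ∈ A, u a = i ∧ v a = j ∧ w a = k := by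
    intro j k hne
    obtain ⟨a, ha⟩ := card_pos.mp (Nat.pos_of_ne_zero hne)
    rw [mem_filter] at ha
    exact ⟨a, ha.1, ha.2⟩
  by_cases hex : ∃ a ∈ A, ∃ a' ∈ A, u a = i ∧ u a' = i ∧ v a ≠ v a'
  · right
    obtain ⟨a, ha, a', ha', hi, hi', hne⟩ := hex
    have hw : w a = w a' := by
      rcases h a ha a' ha' (hi.trans hi'.symm) with h1 | h1
      · exact absurd h1 hne
      · exact h1
    refine ⟨w a, fun j k hjk => ?_⟩
    obtain ⟨b, hb, b1, b2, b3⟩ := mem j k hjk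
    rw [← b3]
    by_contra hcon
    rcases h b hb a ha (b1.trans hi.symm) with h1 | h1
    · rcases h b hb a' ha' (b1.trans hi'.symm) with h2 | h2
      · exact hne (h1.symm.trans h2)
      · exact hcon (h2.trans hw.symm)
    · exact hcon h1
  · left
    push Not at hex
    by_cases hrow : ∃ a ∈ A, u a = i
    · obtain ⟨a, ha, hi⟩ := hrow
      refine ⟨v a, fun j k hjk => ?_⟩
      obtain ⟨b, hb, b1, b2, b3⟩ := mem j k hjk
      rw [← b2]
      exact hex b hb a ha b1 hi
    · refine ⟨0, fun j k hjk => ?_⟩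
      obtain ⟨b, hb, b1, b2, b3⟩ := mem j k hjk
      exact absurd ⟨b, hb, b1⟩ hrow

end Cfg

namespace Cfg
variable {p q r : ℕ} {G : Type} [DecidableEq G] {A B0 B1 B2 B3 : Finset G}
    {u : G → ZMod p} {v : G → ZMod q} {w : G → ZMod r}
    {u2 : G → ZMod (p ^ 2)} {v2 : G → ZMod (q ^ 2)} {w2 : G → ZMod (r ^ 2)}
    {x : ZMod p} {y : ZMod q} {z : ZMod r}

lemma all_false (c : Cfg p q r A B0 B1 B2 B3 u v w u2 v2 w2 x y z)
    (hP : ∃ a ∈ A, ∃ a' ∈ A, u a = u a' ∧ v a ≠ v a' ∧ w a ≠ w a')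
    (hQ : ∃ a ∈ A, ∃ a' ∈ A, v a = v a' ∧ u a ≠ u a' ∧ w a ≠ w a')
    (hR : ∃ a ∈ A, ∃ a' ∈ A, w a = w a' ∧ u a ≠ u a' ∧ v a ≠ v a') : False := by
  obtain ⟨a, ha, a', ha', h1, h2, h3⟩ := hP
  obtain ⟨⟨k1, k2⟩, -⟩ := c.width_u ha ha' h1 h2 h3
  obtain ⟨a, ha, a', ha', h1, h2, h3⟩ := hQ
  obtain ⟨⟨k3, k4⟩, -⟩ := c.swap12.width_u ha ha' h1 h2 h3
  obtain ⟨a, ha, a', ha', h1, h2, h3⟩ := hR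
  obtain ⟨⟨k5, k6⟩, -⟩ := c.swap23.swap12.width_u ha ha' h1 h2 h3
  have b0 := box_card B0 u2 v2 w2 c.inj
  have b1 := box_card B1 u2 v2 w2 c.inj
  have b2 := box_card B2 u2 v2 w2 c.inj
  have b3 := box_card B3 u2 v2 w2 c.inj
  have hc := c.cardB
  have := vol_lt (card_pos.mpr (c.n0.image u2)) (card_pos.mpr (c.n1.image u2))
    (card_pos.mpr (c.n2.image u2)) (card_pos.mpr (c.n3.image u2))
    (card_pos.mpr (c.n0.image v2)) (card_pos.mpr (c.n1.image v2))
    (card_pos.mpr (c.n2.image v2)) (card_pos.mpr (c.n3.image v2))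
    (card_pos.mpr (c.n0.image w2)) (card_pos.mpr (c.n1.image w2))
    (card_pos.mpr (c.n2.image w2)) (card_pos.mpr (c.n3.image w2)) k1 k2 k3 k4 k5 k6
  omega

lemma finish {v : G → ZMod 2} {v2 : G → ZMod (2 ^ 2)} {y : ZMod 2}
    (c : Cfg p 2 r A B0 B1 B2 B3 u v w u2 v2 w2 x y z) {a1 a2 a3 a4 : G}
    (m1 : a1 ∈ A) (m2 : a2 ∈ A) (m3 : a3 ∈ A) (m4 : a4 ∈ A) (hne : a1 ≠ a2)
    (u12 : u a1 = u a2) (v12 : v a1 = v a2) (w12 : w a1 = w a2)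
    (u13 : u a1 ≠ u a3) (v13 : v a1 = v a3) (w13 : w a1 ≠ w a3)
    (u14 : u a1 ≠ u a4) (v14 : v a1 ≠ v a4) (w14 : w a1 = w a4) : False := by
  have hr3 : 3 ≤ r := by
    have := c.hr.two_le
    have := c.hqr
    omega
  have hp2 := c.hp.two_le
  obtain ⟨⟨k3, k4⟩, -⟩ := c.swap12.width_u m1 m3 v13 u13 w13
  obtain ⟨⟨k5, k6⟩, ka⟩ := c.swap23.swap12.width_u m1 m4 w14 u14 v14
  obtain ⟨-, kb⟩ := c.swap23.swap12.width_u m2 m4 (w12 ▸ w14) (u12 ▸ u14) (v12 ▸ v14)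
  have b0 := box_card B0 u2 v2 w2 c.inj
  have b1 := box_card B1 u2 v2 w2 c.inj
  have b2 := box_card B2 u2 v2 w2 c.inj
  have b3 := box_card B3 u2 v2 w2 c.inj
  have hc := c.cardB
  have py0 := card_pos.mpr (c.n0.image v2)
  have py1 := card_pos.mpr (c.n1.image v2)
  have py2 := card_pos.mpr (c.n2.image v2)
  have py3 := card_pos.mpr (c.n3.image v2)
  have y0 : (B0.image v2).card = 1 := by omega
  have y1 : (B1.image v2).card = 1 := by omega
  have y2 : (B2.image v2).card = 1 := by omega
  have y3 : (B3.image v2).card = 1 := by omega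
  have x0 := c.fu B0 (fun g hg h hh => (c.t0 g hg).1.trans (c.t0 h hh).1.symm)
  have x1 := c.fu B1 (fun g hg h hh => (c.t1 g hg).1.trans (c.t1 h hh).1.symm)
  have x2 := c.fu B2 (fun g hg h hh => (c.t2 g hg).1.trans (c.t2 h hh).1.symm)
  have x3 := c.fu B3 (fun g hg h hh => (c.t3 g hg).1.trans (c.t3 h hh).1.symm)
  rw [y0, mul_one] at b0
  rw [y1, mul_one] at b1
  rw [y2, mul_one] at b2
  rw [y3, mul_one] at b3
  have d0 := b0.trans (Nat.mul_le_mul_right _ x0)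
  have d1 := b1.trans (Nat.mul_le_mul_right _ x1)
  have d2 := b2.trans (Nat.mul_le_mul_right _ x2)
  have d3 := b3.trans (Nat.mul_le_mul_right _ x3)
  have hsmall : ¬ (((B0.image w2).card = 1 ∧ (B3.image w2).card = 1) ∧
      (B1.image w2).card = 1 ∧ (B2.image w2).card = 1) := by
    rintro ⟨⟨e0, e3⟩, e1, e2⟩
    rw [e0] at d0
    rw [e1] at d1
    rw [e2] at d2
    rw [e3] at d3
    have : p * 2 * r ≥ p * 2 * 3 := Nat.mul_le_mul_left _ hr3
    omega
  have wa : w2 a1 = w2 a4 := by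
    by_contra h
    exact hsmall (ka h)
  have wb : w2 a2 = w2 a4 := by
    by_contra h
    exact hsmall (kb h)
  have w212 : w2 a1 = w2 a2 := wa.trans wb.symm
  have hz0 := card_pos.mpr (c.n0.image w2)
  have big : (B0.image w2).card < B0.card := by
    have e1 : p * (B0.image w2).card + p * (B3.image w2).card ≤ p * r := by
      rw [← mul_add]; exact Nat.mul_le_mul_left _ k5
    have e2 : p * (B1.image w2).card + p * (B2.image w2).card ≤ p * r := by
      rw [← mul_add]; exact Nat.mul_le_mul_left _ k6
    have e3 : p * 2 * r = p * r + p * r := by ring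
    have e4 : 2 * (B0.image w2).card ≤ p * (B0.image w2).card := Nat.mul_le_mul_right _ hp2
    omega
  have vne : v2 a1 ≠ v2 a2 := by
    intro v212
    obtain ⟨b, hb, b', hb', hbne, hbw⟩ := exists_ne_map_eq_of_card_lt_of_maps_to big
      (fun g hg => mem_image_of_mem w2 hg)
    obtain ⟨t, ht⟩ := card_eq_one.mp y0
    have hv0 : ∀ g ∈ B0, v2 g = t := fun g hg => by
      have := mem_image_of_mem v2 hg
      rw [ht] at this
      exact mem_singleton.mp this
    have hbv : v2 b = v2 b' := (hv0 b hb).trans (hv0 b' hb').symm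
    have hbu : ¬ u2 b = u2 b' := fun h => hbne (c.inj _ _ h hbv hbw)
    have hau : ¬ u2 a1 = u2 a2 := fun h => hne (c.inj _ _ h v212 w212)
    exact hne (c.sands a1 a2 b b' m1 m2 (Or.inl hb) (Or.inl hb')
      (iff_of_true u12 ((c.t0 b hb).1.trans (c.t0 b' hb').1.symm))
      (iff_of_true v12 (c.hv _ _ hbv)) (iff_of_true w12 (c.hw _ _ hbw))
      (iff_of_false hau hbu) (iff_of_true v212 hbv) (iff_of_true w212 hbw))
  obtain ⟨b, hb⟩ := c.n0
  obtain ⟨b', hb'⟩ := c.n2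
  obtain ⟨f1, f2, f3⟩ := c.t0 b hb
  obtain ⟨g1, g2, g3⟩ := c.t2 b' hb'
  have ub : u b ≠ u b' := by rw [f1, g1]; exact c.hx.symm
  have vb : v b = v b' := by rw [f2, g2]
  have wb' : w b ≠ w b' := by rw [f3, g3]; exact c.hz.symm
  have X1 := c.swap12.xor_u m1 m3 (Or.inl hb) (Or.inr (Or.inl hb')) v13 u13 w13 vb ub wb'
  have X2 := c.swap12.xor_u m2 m3 (Or.inl hb) (Or.inr (Or.inl hb')) (v12 ▸ v13) (u12 ▸ u13)
    (w12 ▸ w13) vb ub wb'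
  by_cases h : v2 a1 = v2 a3
  · exact vne (h.trans (X2.mpr (X1.mp h)).symm)
  · have h' : ¬ v2 a2 = v2 a3 := fun e => h (X1.mpr (X2.mp e))
    have := c.fv {a1, a2, a3} (by
      have k : ∀ g ∈ ({a1, a2, a3} : Finset G), v g = v a1 := by
        intro g hg
        simp only [mem_insert, mem_singleton] at hg
        rcases hg with rfl | rfl | rfl
        · rfl
        · exact v12.symm
        · exact v13.symm
      intro g hg h hh
      rw [k g hg, k h hh])
    rw [image_insert, image_insert, image_singleton, card_insert_of_notMem, card_insert_of_notMem,
      card_singleton] at this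
    · omega
    · simpa using h'
    · simpa using ⟨vne, h⟩

lemma main2 {v : G → ZMod 2} {v2 : G → ZMod (2 ^ 2)} {y : ZMod 2}
    (c : Cfg p 2 r A B0 B1 B2 B3 u v w u2 v2 w2 x y z)
    (hQC : ∀ i, QC (cnt A u v w) i) : False := by
  have hp := c.hp
  have hr := c.hr
  choose J hJ using hQC
  have hAJ : ∀ a ∈ A, v a = J (u a) := by
    intro a ha
    apply hJ (u a) (v a) (w a)
    have : 0 < cnt A u v w (u a) (v a) (w a) :=
      card_pos.mpr ⟨a, mem_filter.mpr ⟨ha, rfl, rfl, rfl⟩⟩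
    omega
  obtain ⟨s, hs, s', hs', hss⟩ := c.av
  rw [hAJ s hs, hAJ s' hs'] at hss
  have h2 := two_rows (cnt A u v w) hp hr c.hpq c.hqr.symm c.hx c.hy c.hz
    (card_pos.mpr c.n0) (card_pos.mpr c.n2)
    (Nat.mul_pos (Nat.mul_pos hp.pos two_pos) hr.pos) c.cardB c.conv J hJ ⟨_, _, hss⟩
  obtain ⟨i3, h31, h32⟩ := exists_not_two hp c.hpq (u s) (u s')
  obtain ⟨i, i', i'', hii, hJi, hJi'⟩ : ∃ i i' i'', i ≠ i' ∧ J i = J i' ∧ J i ≠ J i'' := by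
    by_cases h : J i3 = J (u s)
    · exact ⟨i3, u s, u s', h31, h, h ▸ hss⟩
    · exact ⟨i3, u s', u s, h32, zmod2_eq _ _ _ hss.symm h, h⟩
  have h1ne : (1 : ZMod r) ≠ 0 := by
    have : Fact (1 < r) := ⟨hr.one_lt⟩
    exact one_ne_zero
  have ex : ∀ i k, ∃ a ∈ A, u a = i ∧ v a = J i ∧ w a = k := by
    intro i k
    have : 0 < cnt A u v w i (J i) k := by rw [h2]; exact two_pos
    obtain ⟨a, ha⟩ := card_pos.mp this
    exact ⟨a, (mem_filter.mp ha).1, (mem_filter.mp ha).2⟩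
  obtain ⟨a3, m3, e1, e2, e3⟩ := ex i' 1
  obtain ⟨a4, m4, f1, f2, f3⟩ := ex i'' 0
  obtain ⟨a1, a2, hne, heq⟩ := card_eq_two.mp (h2 i 0)
  obtain ⟨m1, o1, o2, o3⟩ := mem_filter.mp (heq ▸ mem_insert_self a1 _)
  obtain ⟨m2, l1, l2, l3⟩ := mem_filter.mp (heq ▸ mem_insert_of_mem (mem_singleton_self a2))
  refine c.finish m1 m2 m3 m4 hne (o1.trans l1.symm) (o2.trans l2.symm) (o3.trans l3.symm)
    (by rw [o1, e1]; exact hii) (by rw [o2, e2, hJi]) (by rw [o3, e3]; exact h1ne.symm)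
    (by rw [o1, f1]; exact fun h => hJi' (congrArg J h)) (by rw [o2, f2]; exact hJi')
    (by rw [o3, f3])

lemma main1 (c : Cfg p q r A B0 B1 B2 B3 u v w u2 v2 w2 x y z) (hr2 : r ≠ 2)
    (hP : ∀ a ∈ A, ∀ a' ∈ A, u a = u a' → v a = v a' ∨ w a = w a') : False := by
  obtain ⟨e, hQC⟩ := rowlemma (cnt A u v w) c.hp c.hq c.hr c.hpq c.hpr hr2 c.hx c.hy c.hz
    (card_pos.mpr c.n2) (card_pos.mpr c.n3)
    (Nat.mul_pos (Nat.mul_pos c.hp.pos c.hq.pos) c.hr.pos) c.conv (row_type A u v w hP)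
  subst e
  exact c.main2 hQC

lemma main0 (c : Cfg p q r A B0 B1 B2 B3 u v w u2 v2 w2 x y z)
    (hP : ¬ ∃ a ∈ A, ∃ a' ∈ A, u a = u a' ∧ v a ≠ v a' ∧ w a ≠ w a') : False := by
  have hP' : ∀ a ∈ A, ∀ a' ∈ A, u a = u a' → v a = v a' ∨ w a = w a' := by
    intro a ha a' ha' h
    by_contra hcon
    rw [not_or] at hcon
    exact hP ⟨a, ha, a', ha', h, hcon.1, hcon.2⟩
  by_cases hr2 : r = 2
  · exact c.swap23.main1 (fun h => c.hqr (h.trans hr2.symm))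
      (fun a ha a' ha' h => (hP' a ha a' ha' h).symm)
  · exact c.main1 hr2 hP'

lemma contra (c : Cfg p q r A B0 B1 B2 B3 u v w u2 v2 w2 x y z) : False :=
  c.all_false (by_contra c.main0) (by_contra c.swap12.main0) (by_contra c.swap23.swap12.main0)

end Cfg

lemma coprime_dvd3 {p q r n : ℕ} (h1 : p.Coprime q) (h2 : p.Coprime r) (h3 : q.Coprime r)
    (hp : p ∣ n) (hq : q ∣ n) (hr : r ∣ n) : p * q * r ∣ n :=
  Nat.Coprime.mul_dvd_of_dvd_of_dvd (Nat.Coprime.mul_left h2 h3)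
    (Nat.Coprime.mul_dvd_of_dvd_of_dvd h1 hp hq) hr

lemma gcd_ne_one_cases {p q r n : ℕ} (hp : p.Prime) (hq : q.Prime) (hr : r.Prime)
    (h : Nat.gcd n (p ^ 2 * q ^ 2 * r ^ 2) ≠ 1) : p ∣ n ∨ q ∣ n ∨ r ∣ n := by
  by_contra hcon
  simp only [not_or] at hcon
  obtain ⟨h1, h2, h3⟩ := hcon
  apply h
  have c1 := (hp.coprime_iff_not_dvd.mpr h1).symm
  have c2 := (hq.coprime_iff_not_dvd.mpr h2).symm
  have c3 := (hr.coprime_iff_not_dvd.mpr h3).symm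
  exact Nat.Coprime.mul_right (Nat.Coprime.mul_right (c1.pow_right 2) (c2.pow_right 2))
    (c3.pow_right 2)

lemma surj3 {M p q r : ℕ} [NeZero M] (hp : p ∣ M) (hq : q ∣ M) (hr : r ∣ M)
    (pp : NeZero p) (qq : NeZero q) (rr : NeZero r)
    (h1 : p.Coprime q) (h2 : p.Coprime r) (h3 : q.Coprime r)
    (i : ZMod p) (j : ZMod q) (k : ZMod r) :
    ∃ g : ZMod M, ZMod.castHom hp (ZMod p) g = i ∧ ZMod.castHom hq (ZMod q) g = j ∧
      ZMod.castHom hr (ZMod r) g = k := by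
  obtain ⟨m, hm1, hm2⟩ := Nat.chineseRemainder h1 i.val j.val
  obtain ⟨n, hn1, hn2⟩ := Nat.chineseRemainder (Nat.Coprime.mul_left h2 h3) m k.val
  refine ⟨(n : ZMod M), ?_, ?_, ?_⟩
  · rw [map_natCast, ← ZMod.natCast_zmod_val i, ZMod.natCast_eq_natCast_iff]
    exact (hn1.of_dvd (Dvd.intro _ rfl)).trans hm1
  · rw [map_natCast, ← ZMod.natCast_zmod_val j, ZMod.natCast_eq_natCast_iff]
    exact (hn1.of_dvd (Dvd.intro_left _ rfl)).trans hm2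
  · rw [map_natCast, ← ZMod.natCast_zmod_val k, ZMod.natCast_eq_natCast_iff]
    exact hn2

lemma conv_build {M p q r : ℕ} [NeZero M] (hp : p ∣ M) (hq : q ∣ M) (hr : r ∣ M)
    (pp : NeZero p) (qq : NeZero q) (rr : NeZero r)
    (h1 : p.Coprime q) (h2 : p.Coprime r) (h3 : q.Coprime r)
    (hM : (p * q * r) * (p * q * r) = M) {A B B0 B1 B2 B3 : Finset (ZMod M)} (hT : Tiles A B)
    (hsum : ∀ f : ZMod M → ℕ, ∑ b ∈ B, f b =
      ∑ b ∈ B0, f b + ∑ b ∈ B1, f b + ∑ b ∈ B2, f b + ∑ b ∈ B3, f b)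
    (u : ZMod M →+* ZMod p) (v : ZMod M →+* ZMod q) (w : ZMod M →+* ZMod r)
    {x : ZMod p} {y : ZMod q} {z : ZMod r}
    (t0 : ∀ g ∈ B0, u g = 0 ∧ v g = 0 ∧ w g = 0)
    (t1 : ∀ g ∈ B1, u g = 0 ∧ v g = y ∧ w g = z)
    (t2 : ∀ g ∈ B2, u g = x ∧ v g = 0 ∧ w g = z)
    (t3 : ∀ g ∈ B3, u g = x ∧ v g = y ∧ w g = 0) :
    Conv (cnt A u v w) x y z B0.card B1.card B2.card B3.card (p * q * r) := by
  intro i j k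
  let φ : ZMod M →+ ZMod p × ZMod q × ZMod r := (u.prod (v.prod w)).toAddMonoidHom
  have hφ : ∀ g, φ g = (u g, v g, w g) := fun g => rfl
  have hcard : Fintype.card (ZMod p × ZMod q × ZMod r) = p * q * r := by
    rw [Fintype.card_prod, Fintype.card_prod, ZMod.card, ZMod.card, ZMod.card, mul_assoc]
  have hs : Function.Surjective φ := by
    rintro ⟨i, j, k⟩
    obtain ⟨g, g1, g2, g3⟩ := surj3 hp hq hr pp qq rr h1 h2 h3 i j k
    refine ⟨g, ?_⟩
    rw [hφ, ← g1, ← g2, ← g3, Subsingleton.elim u (ZMod.castHom hp (ZMod p)),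
      Subsingleton.elim v (ZMod.castHom hq (ZMod q)),
      Subsingleton.elim w (ZMod.castHom hr (ZMod r))]
  have key := conv_count (N := p * q * r) φ hs (by rw [hcard, hM])
    (by rw [hcard]; exact Nat.pos_of_ne_zero (mul_ne_zero (mul_ne_zero pp.out qq.out) rr.out))
    hT (i, j, k)
  rw [hsum] at key
  have aux : ∀ (S : Finset (ZMod M)) (x : ZMod p) (y : ZMod q) (z : ZMod r),
      (∀ g ∈ S, u g = x ∧ v g = y ∧ w g = z) →
      ∑ b ∈ S, (A.filter (fun a => φ a = (i, j, k) - φ b)).card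
        = cnt A u v w (i - x) (j - y) (k - z) * S.card := by
    intro S x y z hS
    rw [mul_comm, ← smul_eq_mul, ← sum_const]
    apply sum_congr rfl
    intro b hb
    obtain ⟨e1, e2, e3⟩ := hS b hb
    rw [cnt]
    congr 1
    apply filter_congr
    intro a _
    rw [hφ, hφ, e1, e2, e3, Prod.mk_sub_mk, Prod.mk_sub_mk, Prod.mk.injEq, Prod.mk.injEq]
  rw [aux B0 _ _ _ t0, aux B1 _ _ _ t1, aux B2 _ _ _ t2, aux B3 _ _ _ t3] at key
  simpa only [sub_zero] using key

end Helpers2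

/-- Proposition 2.7: under the standing hypotheses with `1 ∉ Div(B)`, `B` is not
of the form `B_p ∪ B_q ∪ B_r ∪ B_{pqr}` with `B_p, B_q, B_r` all nonempty. -/
theorem stmt_13 (p q r M : ℕ) (hp : p.Prime) (hq : q.Prime) (hr : r.Prime)
    (hpq : p ≠ q) (hqr : q ≠ r) (hpr : p ≠ r) (hM : M = p ^ 2 * q ^ 2 * r ^ 2)
    (A B : Finset (ZMod M)) (hT : Tiles A B)
    (hA : A.card = p * q * r) (hB : B.card = p * q * r)
    (h0A : (0 : ZMod M) ∈ A) (h0B : (0 : ZMod M) ∈ B)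
    (hApr : NotInProperSubgroup A) (hBpr : NotInProperSubgroup B)
    (hone : 1 ∉ DivSet B) :
    ¬ ( (B.filter fun x => p ∣ x.val ∧ ¬ q ∣ x.val ∧ ¬ r ∣ x.val).Nonempty ∧
        (B.filter fun x => q ∣ x.val ∧ ¬ r ∣ x.val ∧ ¬ p ∣ x.val).Nonempty ∧
        (B.filter fun x => r ∣ x.val ∧ ¬ p ∣ x.val ∧ ¬ q ∣ x.val).Nonempty ∧
        B = (B.filter fun x => p ∣ x.val ∧ ¬ q ∣ x.val ∧ ¬ r ∣ x.val)
          ∪ (B.filter fun x => q ∣ x.val ∧ ¬ r ∣ x.val ∧ ¬ p ∣ x.val)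
          ∪ (B.filter fun x => r ∣ x.val ∧ ¬ p ∣ x.val ∧ ¬ q ∣ x.val)
          ∪ (B.filter fun x => (p * q * r) ∣ x.val) ) := by
  rintro ⟨⟨e1, he1⟩, ⟨e2, he2⟩, ⟨e3, he3⟩, hU⟩
  have hM0 : M ≠ 0 := by
    rw [hM]
    exact mul_ne_zero (mul_ne_zero (pow_ne_zero _ hp.ne_zero) (pow_ne_zero _ hq.ne_zero))
      (pow_ne_zero _ hr.ne_zero)
  have : NeZero M := ⟨hM0⟩
  have dp2 : p ^ 2 ∣ M := ⟨q ^ 2 * r ^ 2, by rw [hM]; ring⟩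
  have dq2 : q ^ 2 ∣ M := ⟨p ^ 2 * r ^ 2, by rw [hM]; ring⟩
  have dr2 : r ^ 2 ∣ M := ⟨p ^ 2 * q ^ 2, by rw [hM]; ring⟩
  have sp : p ∣ p ^ 2 := dvd_pow_self p two_ne_zero
  have sq : q ∣ q ^ 2 := dvd_pow_self q two_ne_zero
  have sr : r ∣ r ^ 2 := dvd_pow_self r two_ne_zero
  have dp : p ∣ M := sp.trans dp2
  have dq : q ∣ M := sq.trans dq2
  have dr : r ∣ M := sr.trans dr2
  have cpq : p.Coprime q := (Nat.coprime_primes hp hq).mpr hpq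
  have cpr : p.Coprime r := (Nat.coprime_primes hp hr).mpr hpr
  have cqr : q.Coprime r := (Nat.coprime_primes hq hr).mpr hqr
  have hMM : (p * q * r) * (p * q * r) = M := by rw [hM]; ring
  have hcard : A.card * B.card = M := by rw [hA, hB, hMM]
  have hM1 : 1 < M := lt_of_lt_of_le hp.one_lt (Nat.le_of_dvd (Nat.pos_of_ne_zero hM0) dp)
  set B1 := B.filter fun x => p ∣ x.val ∧ ¬ q ∣ x.val ∧ ¬ r ∣ x.val with hB1
  set B2 := B.filter fun x => q ∣ x.val ∧ ¬ r ∣ x.val ∧ ¬ p ∣ x.val with hB2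
  set B3 := B.filter fun x => r ∣ x.val ∧ ¬ p ∣ x.val ∧ ¬ q ∣ x.val with hB3
  set B0 := B.filter fun x => (p * q * r) ∣ x.val with hB0
  let u := ZMod.castHom dp (ZMod p)
  let v := ZMod.castHom dq (ZMod q)
  let w := ZMod.castHom dr (ZMod r)
  let u2 := ZMod.castHom dp2 (ZMod (p ^ 2))
  let v2 := ZMod.castHom dq2 (ZMod (q ^ 2))
  let w2 := ZMod.castHom dr2 (ZMod (r ^ 2))
  have zu : ∀ g, u g = 0 ↔ p ∣ g.val := cast_zero_iff dp
  have zv : ∀ g, v g = 0 ↔ q ∣ g.val := cast_zero_iff dq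
  have zw : ∀ g, w g = 0 ↔ r ∣ g.val := cast_zero_iff dr
  have m0 : ∀ g ∈ B0, g ∈ B ∧ u g = 0 ∧ v g = 0 ∧ w g = 0 := by
    intro g hg
    obtain ⟨h, hd⟩ := mem_filter.mp hg
    exact ⟨h, (zu g).mpr (((Dvd.intro _ rfl).trans (Dvd.intro _ rfl)).trans hd),
      (zv g).mpr (((Dvd.intro_left _ rfl).trans (Dvd.intro _ rfl)).trans hd),
      (zw g).mpr ((Dvd.intro_left _ rfl).trans hd)⟩
  have m1 : ∀ g ∈ B1, g ∈ B ∧ u g = 0 ∧ v g ≠ 0 ∧ w g ≠ 0 := by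
    intro g hg
    obtain ⟨h, h1, h2, h3⟩ := mem_filter.mp hg
    exact ⟨h, (zu g).mpr h1, mt (zv g).mp h2, mt (zw g).mp h3⟩
  have m2 : ∀ g ∈ B2, g ∈ B ∧ u g ≠ 0 ∧ v g = 0 ∧ w g ≠ 0 := by
    intro g hg
    obtain ⟨h, h1, h2, h3⟩ := mem_filter.mp hg
    exact ⟨h, mt (zu g).mp h3, (zv g).mpr h1, mt (zw g).mp h2⟩
  have m3 : ∀ g ∈ B3, g ∈ B ∧ u g ≠ 0 ∧ v g ≠ 0 ∧ w g = 0 := by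
    intro g hg
    obtain ⟨h, h1, h2, h3⟩ := mem_filter.mp hg
    exact ⟨h, mt (zu g).mp h2, mt (zv g).mp h3, (zw g).mpr h1⟩
  have inB : ∀ g, (g ∈ B0 ∨ g ∈ B1 ∨ g ∈ B2 ∨ g ∈ B3) → g ∈ B := by
    rintro g (h | h | h | h)
    exacts [(m0 g h).1, (m1 g h).1, (m2 g h).1, (m3 g h).1]
  have agree : ∀ b ∈ B, ∀ b' ∈ B, u b = u b' ∨ v b = v b' ∨ w b = w b' := by
    intro b hb b' hb'
    have hg : Nat.gcd (b - b').val (p ^ 2 * q ^ 2 * r ^ 2) ≠ 1 := fun h =>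
      hone ⟨b, hb, b', hb', by rw [← h, ← hM]⟩
    rcases gcd_ne_one_cases hp hq hr hg with h | h | h
    · exact Or.inl ((cast_eq_iff dp _ _).mpr h)
    · exact Or.inr (Or.inl ((cast_eq_iff dq _ _).mpr h))
    · exact Or.inr (Or.inr ((cast_eq_iff dr _ _).mpr h))
  have a12 : ∀ b ∈ B1, ∀ b' ∈ B2, w b = w b' := by
    intro b hb b' hb'
    obtain ⟨k0, k1, k2, k3⟩ := m1 b hb
    obtain ⟨l0, l1, l2, l3⟩ := m2 b' hb'
    rcases agree b k0 b' l0 with h | h | h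
    · exact absurd (h.symm.trans k1) l1
    · exact absurd (h.trans l2) k2
    · exact h
  have a13 : ∀ b ∈ B1, ∀ b' ∈ B3, v b = v b' := by
    intro b hb b' hb'
    obtain ⟨k0, k1, k2, k3⟩ := m1 b hb
    obtain ⟨l0, l1, l2, l3⟩ := m3 b' hb'
    rcases agree b k0 b' l0 with h | h | h
    · exact absurd (h.symm.trans k1) l1
    · exact h
    · exact absurd (h.trans l3) k3
  have a23 : ∀ b ∈ B2, ∀ b' ∈ B3, u b = u b' := by
    intro b hb b' hb'
    obtain ⟨k0, k1, k2, k3⟩ := m2 b hb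
    obtain ⟨l0, l1, l2, l3⟩ := m3 b' hb'
    rcases agree b k0 b' l0 with h | h | h
    · exact h
    · exact absurd (h.symm.trans k2) l2
    · exact absurd (h.trans l3) k3
  have t0 : ∀ g ∈ B0, u g = 0 ∧ v g = 0 ∧ w g = 0 := fun g hg => (m0 g hg).2
  have t1 : ∀ g ∈ B1, u g = 0 ∧ v g = v e1 ∧ w g = w e1 := fun g hg =>
    ⟨(m1 g hg).2.1, (a13 g hg e3 he3).trans (a13 e1 he1 e3 he3).symm,
      (a12 g hg e2 he2).trans (a12 e1 he1 e2 he2).symm⟩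
  have t2 : ∀ g ∈ B2, u g = u e2 ∧ v g = 0 ∧ w g = w e1 := fun g hg =>
    ⟨(a23 g hg e3 he3).trans (a23 e2 he2 e3 he3).symm, (m2 g hg).2.2.1, (a12 e1 he1 g hg).symm⟩
  have t3 : ∀ g ∈ B3, u g = u e2 ∧ v g = v e1 ∧ w g = 0 := fun g hg =>
    ⟨(a23 e2 he2 g hg).symm, (a13 e1 he1 g hg).symm, (m3 g hg).2.2.2⟩
  have hsum : ∀ f : ZMod M → ℕ, ∑ b ∈ B, f b =
      ∑ b ∈ B0, f b + ∑ b ∈ B1, f b + ∑ b ∈ B2, f b + ∑ b ∈ B3, f b := by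
    intro f
    have D12 : Disjoint B1 B2 := disjoint_left.mpr fun g h1 h2 => (m1 g h1).2.2.1 (m2 g h2).2.2.1
    have D123 : Disjoint (B1 ∪ B2) B3 := disjoint_left.mpr fun g h1 h2 => by
      rcases mem_union.mp h1 with h | h
      · exact (m1 g h).2.2.2 (m3 g h2).2.2.2
      · exact (m2 g h).2.2.2 (m3 g h2).2.2.2
    have D0 : Disjoint (B1 ∪ B2 ∪ B3) B0 := disjoint_left.mpr fun g h1 h2 => by
      rcases mem_union.mp h1 with h | h
      · rcases mem_union.mp h with h | h
        · exact (m1 g h).2.2.2 (m0 g h2).2.2.2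
        · exact (m2 g h).2.2.2 (m0 g h2).2.2.2
      · exact (m3 g h).2.2.1 (m0 g h2).2.2.1
    have e : ∑ b ∈ B, f b = ∑ b ∈ B1 ∪ B2 ∪ B3 ∪ B0, f b := congrArg (fun S => ∑ b ∈ S, f b) hU
    rw [e, sum_union D0, sum_union D123, sum_union D12]
    omega
  have c : Cfg p q r A B0 B1 B2 B3 u v w u2 v2 w2 (u e2) (v e1) (w e1) :=
    { hp := hp
      hq := hq
      hr := hr
      hpq := hpq
      hqr := hqr
      hpr := hpr
      hu := fun g h e => by
        have := congrArg (ZMod.castHom sp (ZMod p)) e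
        rwa [cast_comp, cast_comp] at this
      hv := fun g h e => by
        have := congrArg (ZMod.castHom sq (ZMod q)) e
        rwa [cast_comp, cast_comp] at this
      hw := fun g h e => by
        have := congrArg (ZMod.castHom sr (ZMod r)) e
        rwa [cast_comp, cast_comp] at this
      inj := fun g h e1 e2 e3 => by
        have := coprime_dvd3 (cpq.pow 2 2) (cpr.pow 2 2) (cqr.pow 2 2)
          ((cast_eq_iff dp2 _ _).mp e1) ((cast_eq_iff dq2 _ _).mp e2) ((cast_eq_iff dr2 _ _).mp e3)
        rw [← hM] at this
        have hz := Nat.eq_zero_of_dvd_of_lt this (ZMod.val_lt _)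
        exact sub_eq_zero.mp ((ZMod.val_eq_zero _).mp hz)
      fu := fun S hS => fiber_card_le hp _ (fun s hs t ht => by
        obtain ⟨g, hg, rfl⟩ := mem_image.mp hs
        obtain ⟨h, hh, rfl⟩ := mem_image.mp ht
        rw [cast_comp, cast_comp]
        exact hS g hg h hh)
      fv := fun S hS => fiber_card_le hq _ (fun s hs t ht => by
        obtain ⟨g, hg, rfl⟩ := mem_image.mp hs
        obtain ⟨h, hh, rfl⟩ := mem_image.mp ht
        rw [cast_comp, cast_comp]
        exact hS g hg h hh)
      fw := fun S hS => fiber_card_le hr _ (fun s hs t ht => by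
        obtain ⟨g, hg, rfl⟩ := mem_image.mp hs
        obtain ⟨h, hh, rfl⟩ := mem_image.mp ht
        rw [cast_comp, cast_comp]
        exact hS g hg h hh)
      sands := fun a a' b b' ha ha' hb hb' h1 h2 h3 h4 h5 h6 => by
        refine sands hM1 hT hcard ha ha' (inB b hb) (inB b' hb') ?_
        have i1 := (cast_eq_iff dp a a').symm.trans (h1.trans (cast_eq_iff dp b b'))
        have i2 := (cast_eq_iff dq a a').symm.trans (h2.trans (cast_eq_iff dq b b'))
        have i3 := (cast_eq_iff dr a a').symm.trans (h3.trans (cast_eq_iff dr b b'))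
        have i4 := (cast_eq_iff dp2 a a').symm.trans (h4.trans (cast_eq_iff dp2 b b'))
        have i5 := (cast_eq_iff dq2 a a').symm.trans (h5.trans (cast_eq_iff dq2 b b'))
        have i6 := (cast_eq_iff dr2 a a').symm.trans (h6.trans (cast_eq_iff dr2 b b'))
        have K : ∀ n : ℕ, n.gcd M = n.gcd (p ^ 2) * n.gcd (q ^ 2) * n.gcd (r ^ 2) := by
          intro n
          rw [← Nat.Coprime.gcd_mul n (cpq.pow 2 2),
            ← Nat.Coprime.gcd_mul n (Nat.Coprime.mul_left (cpr.pow 2 2) (cqr.pow 2 2)), hM]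
        rw [K, K, gcd_sq hp i1 i4, gcd_sq hq i2 i5, gcd_sq hr i3 i6]
      conv := conv_build dp dq dr ⟨hp.ne_zero⟩ ⟨hq.ne_zero⟩ ⟨hr.ne_zero⟩ cpq cpr cqr hMM hT hsum
        u v w t0 t1 t2 t3
      cardB := by
        have := hsum (fun _ => 1)
        simp only [sum_const, smul_eq_mul, mul_one] at this
        rw [← this, hB]
      hx := (m2 e2 he2).2.1
      hy := (m1 e1 he1).2.2.1
      hz := (m1 e1 he1).2.2.2
      n0 := ⟨0, mem_filter.mpr ⟨h0B, by rw [ZMod.val_zero]; exact dvd_zero _⟩⟩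
      n1 := ⟨e1, he1⟩
      n2 := ⟨e2, he2⟩
      n3 := ⟨e3, he3⟩
      t0 := t0
      t1 := t1
      t2 := t2
      t3 := t3
      au := by
        obtain ⟨a, ha, h⟩ := hApr p dp hp.one_lt
        exact ⟨a, ha, 0, h0A, fun e => h ((zu a).mp (e.trans (map_zero u)))⟩
      av := by
        obtain ⟨a, ha, h⟩ := hApr q dq hq.one_lt
        exact ⟨a, ha, 0, h0A, fun e => h ((zv a).mp (e.trans (map_zero v)))⟩
      aw := by
        obtain ⟨a, ha, h⟩ := hApr r dr hr.one_lt
        exact ⟨a, ha, 0, h0A, fun e => h ((zw a).mp (e.trans (map_zero w)))⟩ }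
  exact c.contra
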